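/- Let F be a field of characteristic p > 0 and B a p-algebra of degree m over F which is split by a purely inseparable field extension K/F of exponent one with m < [K:F] = p^e. Then there exist an algebraic derivation δ on K with Const(δ) = F and a differential polynomial f ∈ K[t;δ] of degree m such that the Petit algebra S_f = K[t;δ]/K[t;δ]f is a unital nonassociative algebra over F of dimension m·p^e whose right nucleus is isomorphic to B, whose left and middle nuclei equal K, and whose nucleus Nuc(S_f) = B ∩ K is an intermediate field of K/F that is properly contained in K. -/

import Mathlib

open scoped TensorProduct

/-! ## A framework for differential polynomial rings `K[t;δ]` and Petit algebras `S_f`. -/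

/-- A derivation on a field `K`: an additive map satisfying the Leibniz rule. -/
structure Der (K : Type) [Field K] where
  toFun : K → K
  map_add' : ∀ a b : K, toFun (a + b) = toFun a + toFun b
  leibniz' : ∀ a b : K, toFun (a * b) = a * toFun b + toFun a * b

/-- `F` (given as a subfield of `K` via `algebraMap F K`) is precisely the field of
constants `Const(δ) = {a ∈ K | δ(a) = 0}` of the derivation `δ`. -/
def Der.HasConstants {K : Type} [Field K] (δ : Der K) (F : Type) [Field F]
    [Algebra F K] : Prop :=
  ∀ a : K, δ.toFun a = 0 ↔ ∃ c : F, algebraMap F K c = a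

/-- The map `V_p(b) = b^p + δ^{p-1}(b)`. -/
def Der.Vp {K : Type} [Field K] (δ : Der K) (p : ℕ) (b : K) : K :=
  b ^ p + δ.toFun^[p - 1] b

/-- The `e`-fold iterate `V_{p^e}` of `V_p`. -/
def Der.VpIter {K : Type} [Field K] (δ : Der K) (p e : ℕ) : K → K :=
  (δ.Vp p)^[e]

/-- A realization of the differential polynomial ring `R = K[t;δ]`: a ring `R`
together with an embedding `i : K → R` and an element `t` satisfying the
twist relation `t·a = a·t + δ(a)`, such that every element of `R` is *uniquely*
a left `K`-linear combination of the powers `t^n` (witnessed by the coefficient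
function `coeff`), and such that `R` admits a right division algorithm. -/
structure DiffPolyRing (K : Type) [Field K] (δ : Der K) (R : Type) [Ring R] where
  i : K →+* R
  t : R
  coeff : R → (ℕ →₀ K)
  t_mul : ∀ a : K, t * i a = i a * t + i (δ.toFun a)
  repr' : ∀ x : R, x = (coeff x).sum fun n a => i a * t ^ n
  coeff_unique : ∀ (x : R) (c : ℕ →₀ K), x = (c.sum fun n a => i a * t ^ n) → c = coeff x
  rightDiv : ∀ f x : R, f ≠ 0 → ∃! r : R,
    (∃ q : R, x = q * f + r) ∧ (coeff r).support.max < (coeff f).support.max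

namespace DiffPolyRing

variable {K : Type} [Field K] {δ : Der K} {R : Type} [Ring R]

/-- The degree of a differential polynomial, with `deg 0 = ⊥`. -/
def deg (D : DiffPolyRing K δ R) (x : R) : WithBot ℕ := (D.coeff x).support.max

lemma coeff_zero (D : DiffPolyRing K δ R) : D.coeff 0 = 0 :=
  (D.coeff_unique 0 0 (by simp)).symm

lemma deg_zero (D : DiffPolyRing K δ R) : D.deg 0 = ⊥ := by
  simp [deg, D.coeff_zero]

lemma coeff_add (D : DiffPolyRing K δ R) (x y : R) :
    D.coeff (x + y) = D.coeff x + D.coeff y := by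
  refine (D.coeff_unique _ _ ?_).symm
  rw [Finsupp.sum_add_index' (by simp) (by intro n a b; rw [map_add, add_mul])]
  conv_lhs => rw [D.repr' x, D.repr' y]

lemma coeff_neg (D : DiffPolyRing K δ R) (x : R) : D.coeff (-x) = -D.coeff x := by
  have h := D.coeff_add (-x) x
  rw [neg_add_cancel, D.coeff_zero] at h
  exact eq_neg_of_add_eq_zero_left h.symm

lemma deg_neg (D : DiffPolyRing K δ R) (x : R) : D.deg (-x) = D.deg x := by
  simp [deg, D.coeff_neg]

lemma deg_add_lt (D : DiffPolyRing K δ R) {x y : R} {n : WithBot ℕ}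
    (hx : D.deg x < n) (hy : D.deg y < n) : D.deg (x + y) < n := by
  have hsub : (D.coeff (x + y)).support ⊆ (D.coeff x).support ∪ (D.coeff y).support := by
    rw [D.coeff_add]; exact Finsupp.support_add
  calc D.deg (x + y) ≤ ((D.coeff x).support ∪ (D.coeff y).support).max :=
        Finset.max_mono hsub
    _ = max (D.deg x) (D.deg y) := Finset.max_union
    _ < n := max_lt hx hy

lemma coeff_smul (D : DiffPolyRing K δ R) (c : K) (x : R) :
    D.coeff (D.i c * x) = c • D.coeff x := by
  refine (D.coeff_unique _ _ ?_).symm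
  rw [Finsupp.sum_smul_index (by simp)]
  conv_lhs => rw [D.repr' x, Finsupp.mul_sum]
  exact Finsupp.sum_congr fun n _ => by rw [← mul_assoc, ← map_mul]

lemma deg_i_mul_lt (D : DiffPolyRing K δ R) (c : K) {x : R} {n : WithBot ℕ}
    (hx : D.deg x < n) : D.deg (D.i c * x) < n := by
  have hsub : (D.coeff (D.i c * x)).support ⊆ (D.coeff x).support := by
    rw [D.coeff_smul]; exact Finsupp.support_smul
  exact lt_of_le_of_lt (Finset.max_mono hsub) hx

/-- The additive subgroup of `R` consisting of the differential polynomials of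
degree `< m`; this is the underlying set of the Petit algebra `S_f` for `deg f = m`. -/
def res (D : DiffPolyRing K δ R) (m : ℕ) : AddSubgroup R where
  carrier := {x | D.deg x < (m : WithBot ℕ)}
  add_mem' hx hy := D.deg_add_lt hx hy
  zero_mem' := by
    show D.deg 0 < (m : WithBot ℕ)
    rw [D.deg_zero]
    exact bot_lt_iff_ne_bot.2 (by simp)
  neg_mem' {x} hx := by
    show D.deg (-x) < (m : WithBot ℕ)
    rw [D.deg_neg]; exact hx

/-- The underlying set `{g ∈ K[t;δ] | deg g < m}` of the Petit algebra `S_f`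
(for `f` of degree `m`), viewed as a subset of `R = K[t;δ]`. -/
def SfSet (D : DiffPolyRing K δ R) (m : ℕ) : Set R := {x | D.deg x < (m : WithBot ℕ)}

/-- The underlying `F`-vector space of the Petit algebra `S_f`, for `f` of degree `m`. -/
abbrev Rlt (D : DiffPolyRing K δ R) (m : ℕ) : Type := ↥(D.res m)

instance instSMul {F : Type} [Field F] [Algebra F K] (D : DiffPolyRing K δ R) (m : ℕ) :
    SMul F (D.Rlt m) :=
  ⟨fun c x => ⟨D.i (algebraMap F K c) * (x : R), D.deg_i_mul_lt _ x.2⟩⟩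

lemma smul_coe {F : Type} [Field F] [Algebra F K] (D : DiffPolyRing K δ R) (m : ℕ)
    (c : F) (x : D.Rlt m) : ((c • x : D.Rlt m) : R) = D.i (algebraMap F K c) * (x : R) := rfl

/-- The `F`-vector space structure of the Petit algebra (where `F ⊆ K` is the field
of constants): `c • x = i(c)·x`. -/
instance instModule {F : Type} [Field F] [Algebra F K] (D : DiffPolyRing K δ R) (m : ℕ) :
    Module F (D.Rlt m) where
  one_smul x := Subtype.ext <| by rw [smul_coe]; simp
  mul_smul a b x := Subtype.ext <| by rw [smul_coe, smul_coe, smul_coe]; simp [mul_assoc]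
  smul_zero a := Subtype.ext <| by rw [smul_coe]; simp
  smul_add a x y := Subtype.ext <| by
    rw [smul_coe]
    push_cast
    rw [smul_coe, smul_coe, mul_add]
  add_smul a b x := Subtype.ext <| by
    push_cast
    rw [smul_coe, smul_coe, smul_coe]
    simp [add_mul]
  zero_smul x := Subtype.ext <| by rw [smul_coe]; simp

open Classical in
/-- The remainder `mod_r f` of right division by `f`. -/
noncomputable def modr (D : DiffPolyRing K δ R) (f x : R) : R :=
  if h : ∃! r : R, (∃ q : R, x = q * f + r) ∧
      (D.coeff r).support.max < (D.coeff f).support.max then h.choose else 0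

/-- The multiplication of the Petit algebra `S_f`: `g ∘ h = g·h mod_r f`. -/
noncomputable def pmul (D : DiffPolyRing K δ R) (f x y : R) : R := D.modr f (x * y)

/-- The left nucleus of the Petit algebra `S_f`, as a subset of `R`. -/
def nucl (D : DiffPolyRing K δ R) (f : R) (m : ℕ) : Set R :=
  {x ∈ D.SfSet m | ∀ y ∈ D.SfSet m, ∀ z ∈ D.SfSet m,
    D.pmul f (D.pmul f x y) z = D.pmul f x (D.pmul f y z)}

/-- The middle nucleus of the Petit algebra `S_f`, as a subset of `R`. -/
def nucm (D : DiffPolyRing K δ R) (f : R) (m : ℕ) : Set R :=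
  {x ∈ D.SfSet m | ∀ y ∈ D.SfSet m, ∀ z ∈ D.SfSet m,
    D.pmul f (D.pmul f y x) z = D.pmul f y (D.pmul f x z)}

/-- The right nucleus of the Petit algebra `S_f`, as a subset of `R`. -/
def nucr (D : DiffPolyRing K δ R) (f : R) (m : ℕ) : Set R :=
  {x ∈ D.SfSet m | ∀ y ∈ D.SfSet m, ∀ z ∈ D.SfSet m,
    D.pmul f (D.pmul f y z) x = D.pmul f y (D.pmul f z x)}

/-- The nucleus of the Petit algebra `S_f`, as a subset of `R`. -/
def nuc (D : DiffPolyRing K δ R) (f : R) (m : ℕ) : Set R :=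
  D.nucl f m ∩ D.nucm f m ∩ D.nucr f m

/-- `f` is irreducible in `K[t;δ]`: it is not a unit and admits no factorization
into two factors of strictly smaller degree. -/
def Irred (D : DiffPolyRing K δ R) (f : R) : Prop :=
  ¬IsUnit f ∧ ¬∃ g h : R, f = g * h ∧ D.deg g < D.deg f ∧ D.deg h < D.deg f

/-- The Petit algebra `S_f` is a division algebra: it is nonzero, and all left and
right multiplications by nonzero elements are bijective. -/
def IsDivisionPetit (D : DiffPolyRing K δ R) (f : R) (m : ℕ) : Prop :=
  (∃ x ∈ D.SfSet m, x ≠ 0) ∧ ∀ a ∈ D.SfSet m, a ≠ 0 →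
    Set.BijOn (fun x => D.pmul f a x) (D.SfSet m) (D.SfSet m) ∧
    Set.BijOn (fun x => D.pmul f x a) (D.SfSet m) (D.SfSet m)

/-- The unital `F`-algebra `B` realizes the right nucleus of the Petit algebra `S_f`:
there is a bijection `B ≃ Nuc_r(S_f)` preserving addition, multiplication and the
`F`-algebra structure. -/
def RightNucPresents (F : Type) [Field F] [Algebra F K] (D : DiffPolyRing K δ R)
    (f : R) (m : ℕ) (B : Type) [Ring B] [Algebra F B] : Prop :=
  ∃ φ : B ≃ (D.nucr f m),
    (∀ x y : B, ((φ (x + y) : R)) = (φ x : R) + (φ y : R)) ∧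
    (∀ x y : B, ((φ (x * y) : R)) = D.pmul f (φ x : R) (φ y : R)) ∧
    (∀ c : F, ((φ (algebraMap F B c) : R)) = D.i (algebraMap F K c))

/-- A subset `S` of an `F`-vector space has dimension `d`: it contains `d` linearly
independent vectors whose span contains `S`. -/
def SetDim (F : Type) [Field F] {M : Type} [AddCommGroup M] [Module F M]
    (S : Set M) (d : ℕ) : Prop :=
  ∃ s : Finset M, ↑s ⊆ S ∧ s.card = d ∧
    LinearIndependent F (fun x : (s : Set M) => (x : M)) ∧
    S ⊆ (Submodule.span F (s : Set M) : Set M)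

/-- `f ∈ K[t;δ]` of degree `m` is an `A`-polynomial (over the field of constants `F`),
via Amitsur's characterization: the right nucleus of `S_f` has dimension `m²` over `F`. -/
def IsAPoly (F : Type) [Field F] [Algebra F K] (D : DiffPolyRing K δ R)
    (f : R) (m : ℕ) : Prop :=
  SetDim F {x : D.Rlt m | (x : R) ∈ D.nucr f m} (m ^ 2)

/-- `f ∈ R = K[t;δ]` is bounded: there is `f* ≠ 0` such that `Rf* = f*R` is the
largest two-sided ideal of `R` contained in `Rf`. -/
def IsBounded (D : DiffPolyRing K δ R) (f : R) : Prop :=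
  ∃ fs : R, fs ≠ 0 ∧
    {x : R | ∃ r, x = r * fs} = {x : R | ∃ r, x = fs * r} ∧
    (∀ x : R, (∃ r, x = r * fs) → ∃ r, x = r * f) ∧
    ∀ J : Set R, (0 : R) ∈ J → (∀ a ∈ J, ∀ b ∈ J, a + b ∈ J) →
      (∀ r : R, ∀ a ∈ J, r * a ∈ J ∧ a * r ∈ J) →
      (∀ x ∈ J, ∃ r, x = r * f) → ∀ x ∈ J, ∃ r, x = r * fs

/-- `S_f` is a free right module of rank `n` over its right nucleus. -/
def FreeRankOverNucr (D : DiffPolyRing K δ R) (f : R) (m n : ℕ) : Prop :=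
  ∃ b : Fin n → R, (∀ j, b j ∈ D.SfSet m) ∧
    ∀ x ∈ D.SfSet m, ∃! c : Fin n → (D.nucr f m),
      x = ∑ j, D.pmul f (b j) ((c j : R))

/-- The Petit algebra `S_f` is unital with unit `1 ∈ K[t;δ]`. -/
def PetitUnital (D : DiffPolyRing K δ R) (f : R) (m : ℕ) : Prop :=
  (1 : R) ∈ D.SfSet m ∧ ∀ x ∈ D.SfSet m, D.pmul f 1 x = x ∧ D.pmul f x 1 = x

end DiffPolyRing

/-! ### Helpers for the characteristic `p` theory -/

/-- `B` is a `p`-algebra over `F`: a (finite-dimensional) central simple `F`-algebra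
whose index is a power of `p`, i.e. `B ≅ Mat_k(Dv)` for a central division algebra `Dv`
of degree a power of `p`. -/
def IsPAlgebra (p : ℕ) (F B : Type) [Field F] [Ring B] [Algebra F B] : Prop :=
  Algebra.IsCentral F B ∧ IsSimpleRing B ∧
    ∃ (Dv : Type) (_ : DivisionRing Dv) (_ : Algebra F Dv) (k n : ℕ),
      Nonempty (B ≃ₐ[F] Matrix (Fin k) (Fin k) Dv) ∧ Module.finrank F Dv = (p ^ n) ^ 2

/-- `δ` is an algebraic derivation of degree `p^e` with minimum polynomial
`g(t) = t^{p^e} + c₁ t^{p^{e-1}} + ⋯ + c_e t` (coefficients in the constant field `F`):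
`g(δ) = 0` as an additive map on `K`, and no `p`-polynomial of smaller degree
annihilates `δ`. -/
def Der.IsMinPoly {K : Type} [Field K] (δ : Der K) {F : Type} [Field F] [Algebra F K]
    (p e : ℕ) (c : Fin e → F) : Prop :=
  (∀ a : K, δ.toFun^[p ^ e] a
      + ∑ i : Fin e, algebraMap F K (c i) * δ.toFun^[p ^ (e - 1 - (i : ℕ))] a = 0) ∧
  ∀ e' : ℕ, e' < e → ∀ c' : Fin e' → F, ¬ ∀ a : K, δ.toFun^[p ^ e'] a
      + ∑ i : Fin e', algebraMap F K (c' i) * δ.toFun^[p ^ (e' - 1 - (i : ℕ))] a = 0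

/-- The two-sided element `z = g(t) - d₀ = t^{p^e} + c₁ t^{p^{e-1}} + ⋯ + c_e t - d₀`
of `K[t;δ]`. -/
def DiffPolyRing.gElt {K : Type} [Field K] {δ : Der K} {R : Type} [Ring R]
    (D : DiffPolyRing K δ R) {F : Type} [Field F] [Algebra F K]
    (p e : ℕ) (c : Fin e → F) (d₀ : F) : R :=
  D.t ^ p ^ e + ∑ i : Fin e, D.i (algebraMap F K (c i)) * D.t ^ p ^ (e - 1 - (i : ℕ))
    - D.i (algebraMap F K d₀)

section DerivationExistence

open Polynomial

/-- A derivation of `L` whose constants are exactly `F` extends to a simple purely inseparable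
extension `M = L(y)` of exponent one, again with constants exactly `F`. -/
lemma exists_derivation_constants_of_simple {p : ℕ} [Fact p.Prime] {F L M : Type*} [Field F]
    [Field L] [Field M] [Algebra F L] [Algebra F M] [Algebra L M] [IsScalarTower F L M]
    [CharP L p] [FiniteDimensional F L] (y : M) (hy : y ∉ (algebraMap L M).range)
    (hyp : y ^ p ∈ (algebraMap F M).range)
    (hsurj : Function.Surjective (aeval y : L[X] →ₐ[L] M))
    (h : ∃ d : Derivation ℤ L L, ∀ x, d x = 0 ↔ x ∈ (algebraMap F L).range) :
    ∃ d : Derivation ℤ M M, ∀ x, d x = 0 ↔ x ∈ (algebraMap F M).range := by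
  obtain ⟨d, hd⟩ := h
  have hp : p.Prime := Fact.out
  obtain ⟨a, ha⟩ := hyp
  let _ : Differential L := ⟨d⟩
  have hdl : ∀ (c : F) (x : L), d (c • x) = c • d x := by
    intro c x
    have h0 : d (algebraMap F L c) = 0 := (hd _).2 ⟨c, rfl⟩
    rw [Algebra.smul_def, Derivation.leibniz, h0]
    simp [Algebra.smul_def]
  let dl : L →ₗ[F] L :=
    { toFun := d
      map_add' := map_add d
      map_smul' := hdl }
  -- some `w` is not in the image of `d`
  obtain ⟨w, hw⟩ : ∃ w, ∀ x, d x ≠ w := by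
    by_contra! hcon
    have hs : Function.Surjective dl := hcon
    have hi : Function.Injective dl := LinearMap.injective_iff_surjective.2 hs
    have h1 : dl 1 = dl 0 := by
      rw [map_zero]
      exact (hd 1).2 ⟨1, map_one _⟩
    exact one_ne_zero (hi h1)
  let g : L[X] := X ^ p - C (algebraMap F L a)
  have hgy : aeval y g = 0 := by
    simp [g, ← ha, ← IsScalarTower.algebraMap_apply F L M]
  have hgirr : Irreducible g := by
    refine X_pow_sub_C_irreducible_of_prime hp fun b hb => hy ⟨b, ?_⟩
    have hcm : CharP M p := charP_of_injective_algebraMap (algebraMap L M).injective p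
    have : (algebraMap L M b) ^ p = y ^ p := by
      rw [← map_pow, hb, ← ha, ← IsScalarTower.algebraMap_apply F L M]
    exact frobenius_inj M p this
  have hgmonic : g.Monic := monic_X_pow_sub_C _ hp.ne_zero
  have hgmin : g = minpoly L y := minpoly.eq_of_irreducible_of_monic hgirr hgy hgmonic
  have hgdeg : g.degree = p := degree_X_pow_sub_C hp.pos _
  let D : Derivation ℤ L[X] L[X] := Differential.implicitDeriv (C w)
  have hda : d (algebraMap F L a) = 0 := (hd _).2 ⟨a, rfl⟩
  have hDg : D g = 0 := by
    simp only [g, D, map_sub, Derivation.leibniz_pow, Differential.implicitDeriv_C,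
      Differential.implicitDeriv_X]
    have : Differential.deriv (algebraMap F L a) = 0 := hda
    rw [this]
    simp
  have hker : ∀ Q : L[X], aeval y Q = 0 → aeval y (D Q) = 0 := by
    intro Q hQ
    obtain ⟨S, rfl⟩ : g ∣ Q := hgmin ▸ minpoly.dvd L y hQ
    rw [Derivation.leibniz, hDg]
    simp [hgy]
  have hcoeff : ∀ (Q : L[X]) j, (D Q).coeff j = d (Q.coeff j) + w * ((j + 1) * Q.coeff (j + 1)) := by
    intro Q j
    simp only [D, Differential.implicitDeriv, Derivation.add_apply, coeff_add,
      Derivation.smul_apply, smul_eq_mul, coeff_C_mul, Differential.coeff_mapCoeffs]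
    congr 2
    change (derivative Q).coeff j = _
    rw [coeff_derivative, mul_comm]
  let δ : Derivation ℤ M M :=
    Derivation.liftOfSurjective (f := (aeval y : L[X] →ₐ[L] M).toRingHom.toIntAlgHom) hsurj hker
  have hδ : ∀ Q : L[X], δ (aeval y Q) = aeval y (D Q) := fun Q =>
    Derivation.liftOfSurjective_apply
      (f := (aeval y : L[X] →ₐ[L] M).toRingHom.toIntAlgHom) hsurj hker Q
  refine ⟨δ, fun x => ⟨fun hx => ?_, ?_⟩⟩
  · obtain ⟨Q, rfl⟩ := hsurj x
    -- reduce to degree `< p`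
    obtain ⟨P, hPdeg, hPQ⟩ : ∃ P : L[X], P.degree < p ∧ aeval y P = aeval y Q := by
      refine ⟨Q %ₘ g, hgdeg ▸ degree_modByMonic_lt Q hgmonic, ?_⟩
      exact aeval_modByMonic_eq_self_of_root hgy
    rw [← hPQ] at hx ⊢
    rw [hδ] at hx
    have hDP : D P = 0 := by
      by_contra hne
      have h1 : g ∣ D P := hgmin ▸ minpoly.dvd L y hx
      have h2 := degree_le_of_dvd h1 hne
      have h3 : (D P).degree < p := by
        rw [degree_lt_iff_coeff_zero] at hPdeg ⊢
        intro j hj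
        rw [hcoeff, hPdeg j hj, hPdeg (j + 1) (by omega)]
        simp
      rw [hgdeg] at h2
      exact absurd h2 (not_le.2 h3)
    have hc : ∀ j, d (P.coeff j) + w * ((j + 1) * P.coeff (j + 1)) = 0 := fun j => by
      rw [← hcoeff, hDP, coeff_zero]
    rcases hn : P.natDegree with _ | n
    · rw [eq_C_of_natDegree_eq_zero hn]
      have h0 := hc 0
      rw [coeff_eq_zero_of_natDegree_lt (n := 0 + 1) (by omega)] at h0
      obtain ⟨b, hb⟩ := (hd _).1 (by simpa using h0)
      exact ⟨b, by simp [← hb, ← IsScalarTower.algebraMap_apply F L M]⟩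
    · exfalso
      have hlead : P.coeff (n + 1) ≠ 0 := by
        rw [← hn]
        intro h0
        have := leadingCoeff_eq_zero.1 h0
        simp [this] at hn
      have h1 := hc (n + 1)
      rw [coeff_eq_zero_of_natDegree_lt (n := n + 1 + 1) (by omega)] at h1
      obtain ⟨b, hb⟩ := (hd _).1 (by simpa using h1)
      have hb0 : b ≠ 0 := by
        rintro rfl
        exact hlead (by simp [← hb])
      have hn0 : ((n + 1 : ℕ) : L) ≠ 0 := by
        intro h0
        rw [CharP.cast_eq_zero_iff L p] at h0
        have h2 : P.natDegree < p := by
          rw [natDegree_lt_iff_degree_lt (by rintro rfl; simp at hn)]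
          exact hPdeg
        exact absurd (Nat.le_of_dvd (by omega) h0) (by omega)
      have hdn : d ((n + 1 : ℕ) : L) = 0 := by simp
      apply hw (((n + 1 : ℕ) : L)⁻¹ * (b⁻¹ • (- P.coeff n)))
      have hdinv : d (((n + 1 : ℕ) : L)⁻¹) = 0 := by
        rw [Derivation.leibniz_inv, hdn]; simp
      rw [Derivation.leibniz, hdinv, hdl, map_neg, smul_zero, add_zero,
        eq_neg_of_add_eq_zero_left (hc n), ← hb]
      simp only [Algebra.smul_def, neg_neg, map_inv₀]
      have hb1 : algebraMap F L b ≠ 0 := by simpa using hb0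
      push_cast at hn0 ⊢
      field_simp
  · rintro ⟨c, rfl⟩
    have h1 : algebraMap F M c = aeval y (C (algebraMap F L c)) := by
      simp [← IsScalarTower.algebraMap_apply F L M]
    rw [h1, hδ]
    have h2 : Differential.deriv (algebraMap F L c) = 0 := (hd _).2 ⟨c, rfl⟩
    simp [D, h2]

/-- A finite purely inseparable extension `K/F` of exponent one admits a derivation whose field
of constants is exactly `F`. -/
lemma exists_derivation_constants (p : ℕ) [Fact p.Prime] (F K : Type*) [Field F] [CharP F p]
    [Field K] [Algebra F K] [FiniteDimensional F K]
    (hK : ∀ z : K, z ^ p ∈ (algebraMap F K).range) :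
    ∃ d : Derivation ℤ K K, ∀ x, d x = 0 ↔ x ∈ (algebraMap F K).range := by
  let P : IntermediateField F K → Prop := fun L =>
    ∃ d : Derivation ℤ L L, ∀ x, d x = 0 ↔ x ∈ (algebraMap F L).range
  have base : P ⊥ := by
    refine ⟨0, fun x => ⟨fun _ => ?_, fun _ => rfl⟩⟩
    obtain ⟨c, hc⟩ := IntermediateField.mem_bot.1 x.2
    exact ⟨c, Subtype.ext hc⟩
  have step : ∀ (L : IntermediateField F K) (x : K), P L →
      P ((IntermediateField.adjoin L {x}).restrictScalars F) := by
    intro L x hL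
    by_cases hx : x ∈ L
    · have : (IntermediateField.adjoin L {x}).restrictScalars F = L := by
        have h1 : IntermediateField.adjoin L {x} = ⊥ :=
          IntermediateField.adjoin_simple_eq_bot_iff.2
            (IntermediateField.mem_bot.2 ⟨⟨x, hx⟩, rfl⟩)
        rw [h1]
        exact IntermediateField.restrictScalars_bot_eq_self L
      rw [this]
      exact hL
    · have hcl : CharP L p := charP_of_injective_algebraMap (algebraMap F L).injective p
      let M := IntermediateField.adjoin L {x}
      let y : M := IntermediateField.AdjoinSimple.gen L x
      change ∃ d : Derivation ℤ M M, ∀ z, d z = 0 ↔ z ∈ (algebraMap F M).range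
      refine exists_derivation_constants_of_simple (p := p) (F := F) (L := L) (M := M) y ?_ ?_ ?_ hL
      · rintro ⟨b, hb⟩
        apply hx
        have := congrArg (algebraMap M K) hb
        rw [IntermediateField.AdjoinSimple.algebraMap_gen] at this
        rw [← this]
        exact b.2
      · obtain ⟨c, hc⟩ := hK x
        exact ⟨c, Subtype.ext hc⟩
      · intro z
        have hint : IsIntegral L x := Algebra.IsIntegral.isIntegral x
        have hz : z ∈ Algebra.adjoin L {IntermediateField.AdjoinSimple.gen L x} := by
          rw [← IntermediateField.adjoin.powerBasis_gen hint,
            (IntermediateField.adjoin.powerBasis hint).adjoin_gen_eq_top]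
          trivial
        rw [Algebra.adjoin_singleton_eq_range_aeval] at hz
        exact hz
  obtain ⟨d, hd⟩ := IntermediateField.induction_on_adjoin P base step ⊤
  let eqv : (⊤ : IntermediateField F K) ≃ₐ[F] K := IntermediateField.topEquiv
  refine ⟨{ toFun := fun x => eqv (d (eqv.symm x)), map_add' := ?_, map_smul' := ?_,
            map_one_eq_zero' := ?_, leibniz' := ?_ }, fun x => ?_⟩
  · intro a b; simp
  · intro a b; simp
  · simp
  · intro a b; simp
  · change eqv (d (eqv.symm x)) = 0 ↔ _
    rw [map_eq_zero_iff _ eqv.injective, hd]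
    constructor
    · rintro ⟨c, hc⟩
      exact ⟨c, by rw [← eqv.apply_symm_apply x, ← hc, eqv.commutes]⟩
    · rintro ⟨c, rfl⟩
      exact ⟨c, by rw [eqv.symm.commutes]⟩

end DerivationExistence

section OperatorIndependence

/-- An `F`-linear derivation of `K` with field of constants `F` generates, together with the
multiplications by elements of `K`, the full endomorphism ring of `K` over `F`. -/
lemma adjoin_mul_derivation_eq_top {F K : Type*} [Field F] [Field K] [Algebra F K]
    [FiniteDimensional F K] (d : K →ₗ[F] K) (hleib : ∀ a b, d (a * b) = a * d b + d a * b)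
    (hconst : ∀ a, d a = 0 → a ∈ (algebraMap F K).range) :
    Algebra.adjoin F (Set.range (LinearMap.mulLeft F (A := K)) ∪ {d}) =
      (⊤ : Subalgebra F (Module.End F K)) := by
  set A : Subalgebra F (Module.End F K) :=
    Algebra.adjoin F (Set.range (LinearMap.mulLeft F (A := K)) ∪ {d}) with hA
  have hmul : ∀ k : K, LinearMap.mulLeft F k ∈ A := fun k =>
    Algebra.subset_adjoin (Or.inl ⟨k, rfl⟩)
  have hdA : d ∈ A := Algebra.subset_adjoin (Or.inr rfl)
  have hsm : ∀ (r : A) (x : K), r • x = (r : Module.End F K) x := fun _ _ => rfl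
  have hsimple : IsSimpleModule A K := by
    rw [isSimpleModule_iff_toSpanSingleton_surjective]
    refine ⟨inferInstance, fun x hx y => ⟨⟨_, hmul (y * x⁻¹)⟩, ?_⟩⟩
    simp [hsm, hx]
  have hd1 : d 1 = 0 := by
    have := hleib 1 1
    simpa using this
  have hend : ∀ φ : Module.End A K, ∃ c : F, ∀ x, φ x = c • x := by
    intro φ
    have h1 : ∀ x, φ x = x * φ 1 := fun x => by
      have := φ.map_smul ⟨_, hmul x⟩ 1
      simpa [hsm] using this
    have h2 : d (φ 1) = 0 := by
      have := φ.map_smul ⟨d, hdA⟩ 1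
      simpa [hsm, hd1] using this.symm
    obtain ⟨c, hc⟩ := hconst _ h2
    exact ⟨c, fun x => by rw [h1, ← hc, Algebra.smul_def, mul_comm]⟩
  rw [eq_top_iff]
  intro g _
  let g' : Module.End (Module.End A K) K :=
    { toFun := g
      map_add' := map_add g
      map_smul' := fun φ x => by
        obtain ⟨c, hc⟩ := hend φ
        simp [hc] }
  let b := Module.finBasis F K
  classical
  obtain ⟨r, hr⟩ := jacobson_density (R := A) (M := K) g' (Finset.univ.image b)
  have : (r : Module.End F K) = g := b.ext fun j => (hr (b j) (by simp)).symm
  exact this ▸ r.2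

/-- If `K` has finite degree over the constants `F` of `d`, no differential operator whose order
is smaller than that degree vanishes identically on `K`. -/
lemma leading_coeff_eq_zero_of_operator_eq_zero {F K : Type*} [Field F] [Field K] [Algebra F K]
    [FiniteDimensional F K] (d : K →ₗ[F] K) (hleib : ∀ a b, d (a * b) = a * d b + d a * b)
    (hconst : ∀ a, d a = 0 → a ∈ (algebraMap F K).range) (n : ℕ) (hn : n < Module.finrank F K)
    (b : ℕ → K) (hb : ∀ a, ∑ j ∈ Finset.range (n + 1), b j * (d ^ j) a = 0) : b n = 0 := by
  by_contra hbn
  rcases Nat.eq_zero_or_pos n with rfl | hpos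
  · have := hb 1
    simp at this
    exact hbn this
  let S : Submodule K (Module.End F K) :=
    Submodule.span K (Set.range fun j : Fin n => d ^ (j : ℕ))
  have hlt : ∀ j < n, d ^ j ∈ S := fun j hj => Submodule.subset_span ⟨⟨j, hj⟩, rfl⟩
  have hdn : d ^ n ∈ S := by
    have h1 : d ^ n = ∑ j ∈ Finset.range n, (-(b n)⁻¹ * b j) • d ^ j := by
      ext a
      have h2 := hb a
      rw [Finset.sum_range_succ] at h2
      have h3 : (d ^ n) a = -(b n)⁻¹ * ∑ j ∈ Finset.range n, b j * (d ^ j) a := by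
        rw [eq_neg_of_add_eq_zero_left h2]
        field_simp
      rw [h3, LinearMap.sum_apply, Finset.mul_sum]
      exact Finset.sum_congr rfl fun j _ => by simp [mul_assoc]
    rw [h1]
    exact Submodule.sum_mem _ fun j hj => S.smul_mem _ (hlt j (Finset.mem_range.1 hj))
  have hdS : ∀ s ∈ S, d * s ∈ S := by
    intro s hs
    induction hs using Submodule.span_induction with
    | mem x hx =>
      obtain ⟨j, rfl⟩ := hx
      change d * d ^ (j : ℕ) ∈ S
      rw [← pow_succ']
      rcases (Nat.succ_le_of_lt j.2).lt_or_eq with h | h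
      · exact hlt _ h
      · rw [← Nat.succ_eq_add_one, h]
        exact hdn
    | zero => simp
    | add x y _ _ hx hy =>
      rw [mul_add]
      exact S.add_mem hx hy
    | smul k x hx' hx =>
      have : d * (k • x) = k • (d * x) + d k • x := by
        ext a
        simp [hleib]
      rw [this]
      exact S.add_mem (S.smul_mem _ hx) (S.smul_mem _ hx')
  have hAS : ∀ x ∈ Algebra.adjoin F (Set.range (LinearMap.mulLeft F (A := K)) ∪ {d}),
      ∀ s ∈ S, x * s ∈ S := by
    intro x hx
    induction hx using Algebra.adjoin_induction with
    | mem x hx =>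
      intro s hs
      rcases hx with ⟨k, rfl⟩ | rfl
      · have : LinearMap.mulLeft F k * s = k • s := by
          ext a
          simp
        rw [this]
        exact S.smul_mem _ hs
      · exact hdS s hs
    | algebraMap c =>
      intro s hs
      have : algebraMap F (Module.End F K) c * s = algebraMap F K c • s := by
        ext a
        simp [Algebra.smul_def]
      rw [this]
      exact S.smul_mem _ hs
    | add x y _ _ hx hy =>
      intro s hs
      rw [add_mul]
      exact S.add_mem (hx s hs) (hy s hs)
    | mul x y _ _ hx hy =>
      intro s hs
      rw [mul_assoc]
      exact hx _ (hy s hs)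
  rw [adjoin_mul_derivation_eq_top d hleib hconst] at hAS
  have htop : S = ⊤ := by
    rw [eq_top_iff]
    intro x _
    simpa using hAS x trivial 1 (by simpa using hlt 0 hpos)
  have h1 : Module.finrank K S ≤ n := by
    refine (finrank_range_le_card (R := K) (fun j : Fin n => d ^ (j : ℕ))).trans ?_
    simp
  rw [htop, finrank_top, Module.finrank_linearMap_self] at h1
  omega

/-- Any sequence in a finite-dimensional space has a term that is a linear combination of the
earlier ones. -/
lemma exists_add_sum_smul_eq_zero {F V : Type*} [Field F] [AddCommGroup V] [Module F V]
    [FiniteDimensional F V] (v : ℕ → V) :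
    ∃ (n : ℕ) (c : Fin n → F), v n + ∑ i : Fin n, c i • v (n - 1 - i) = 0 := by
  by_contra! hcon
  have hmem : ∀ n, v n ∉ Submodule.span F (Set.range fun i : Fin n => v i) := by
    intro n hn
    obtain ⟨c, hc⟩ := (Submodule.mem_span_range_iff_exists_fun F).1 hn
    apply hcon n (fun i => - c i.rev)
    have : ∑ i : Fin n, (- c i.rev) • v (n - 1 - i) = ∑ i : Fin n, (- c i) • v i := by
      refine Fintype.sum_equiv Fin.revPerm _ _ fun i => ?_
      have : n - 1 - (i : ℕ) = n - (i + 1) := by omega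
      simp [Fin.val_rev, this]
    rw [this, ← hc]
    simp
  have hli : ∀ n, LinearIndependent F (fun i : Fin n => v i) := by
    intro n
    induction n with
    | zero => exact linearIndependent_empty_type
    | succ n ih =>
      rw [linearIndependent_finSucc']
      exact ⟨ih, hmem n⟩
  have := (hli (Module.finrank F V + 1)).fintype_card_le_finrank
  simp at this

end OperatorIndependence

section Construction

variable {K : Type} [Field K]

/-- A derivation as an additive map. -/
def Der.toAddHom (δ : Der K) : K →+ K := AddMonoidHom.mk' δ.toFun δ.map_add'

lemma Der.toAddHom_apply (δ : Der K) (a : K) : δ.toAddHom a = δ.toFun a := rfl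

lemma Der.map_zero (δ : Der K) : δ.toFun 0 = 0 := δ.toAddHom.map_zero

lemma Der.map_one (δ : Der K) : δ.toFun 1 = 0 := by
  simpa using δ.leibniz' 1 1

namespace DiffOp

lemma end_mul_apply {M : Type*} [AddCommMonoid M] (f g : AddMonoid.End M) (x : M) :
    (f * g) x = f (g x) := rfl

lemma end_add_apply {M : Type*} [AddCommMonoid M] (f g : AddMonoid.End M) (x : M) :
    (f + g) x = f x + g x := rfl

/-- Left multiplication by `t` on `K[t;δ]`, in terms of coefficients. -/
noncomputable def tOp (δ : Der K) : AddMonoid.End (ℕ →₀ K) :=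
  Finsupp.mapDomain.addMonoidHom Nat.succ + Finsupp.mapRange.addMonoidHom δ.toAddHom

lemma tOp_single (δ : Der K) (n : ℕ) (a : K) :
    tOp δ (Finsupp.single n a) = Finsupp.single (n + 1) a + Finsupp.single n (δ.toFun a) := by
  change Finsupp.mapDomain Nat.succ (Finsupp.single n a) +
    Finsupp.mapRange δ.toAddHom δ.toAddHom.map_zero (Finsupp.single n a) = _
  rw [Finsupp.mapDomain_single, Finsupp.mapRange_single]
  rfl

lemma tOp_apply_succ (δ : Der K) (c : ℕ →₀ K) (j : ℕ) :
    tOp δ c (j + 1) = c j + δ.toFun (c (j + 1)) := by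
  change (Finsupp.mapDomain Nat.succ c) (Nat.succ j) + δ.toFun (c (j + 1)) = _
  rw [Finsupp.mapDomain_apply Nat.succ_injective]

lemma tOp_smul (δ : Der K) (a : K) (c : ℕ →₀ K) :
    tOp δ (a • c) = a • tOp δ c + δ.toFun a • c := by
  induction c using Finsupp.induction_linear with
  | zero => simp
  | add x y hx hy => simp only [smul_add, map_add, hx, hy]; abel
  | single n b =>
    simp only [Finsupp.smul_single, tOp_single, smul_eq_mul, δ.leibniz', smul_add,
      Finsupp.single_add, add_assoc]

section Lift

variable {V : Type*} [AddCommGroup V] [Module K V]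

/-- Multiplication by scalars, as a ring homomorphism. -/
noncomputable def scalar (K V : Type*) [Field K] [AddCommGroup V] [Module K V] :
    K →+* AddMonoid.End V :=
  Module.toAddMonoidEnd K V

lemma scalar_apply (a : K) (v : V) : scalar K V a v = a • v := rfl

/-- The operator `∑ aₙ Tⁿ` on a `K`-space given by the coefficients `aₙ` and an operator `T`. -/
noncomputable def lift (T : AddMonoid.End V) (c : ℕ →₀ K) : AddMonoid.End V :=
  c.sum fun n a => scalar K V a * T ^ n

lemma lift_zero (T : AddMonoid.End V) : lift T (0 : ℕ →₀ K) = 0 := Finsupp.sum_zero_index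

lemma lift_single (T : AddMonoid.End V) (n : ℕ) (a : K) :
    lift T (Finsupp.single n a) = scalar K V a * T ^ n :=
  Finsupp.sum_single_index (by simp)

lemma lift_add (T : AddMonoid.End V) (c c' : ℕ →₀ K) :
    lift T (c + c') = lift T c + lift T c' :=
  Finsupp.sum_add_index' (by simp) (by intro n a b; rw [_root_.map_add, add_mul])

lemma lift_neg (T : AddMonoid.End V) (c : ℕ →₀ K) : lift T (-c) = - lift T c := by
  rw [eq_neg_iff_add_eq_zero, ← lift_add, neg_add_cancel, lift_zero]

lemma lift_one (T : AddMonoid.End V) : lift T (Finsupp.single 0 (1 : K)) = 1 := by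
  simp [lift_single]

lemma scalar_mul_lift (T : AddMonoid.End V) (a : K) (c : ℕ →₀ K) :
    scalar K V a * lift T c = lift T (a • c) := by
  induction c using Finsupp.induction_linear with
  | zero => simp [lift_zero]
  | add x y hx hy => rw [lift_add, mul_add, hx, hy, smul_add, lift_add]
  | single n b =>
    rw [lift_single, Finsupp.smul_single, lift_single, smul_eq_mul, _root_.map_mul, mul_assoc]

variable {δ : Der K} {T : AddMonoid.End V} (hT : ∀ (a : K) v, T (a • v) = a • T v + δ.toFun a • v)
include hT

lemma operator_mul_scalar (a : K) :
    T * scalar K V a = scalar K V a * T + scalar K V (δ.toFun a) :=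
  AddMonoidHom.ext fun v => hT a v

lemma operator_mul_lift (c : ℕ →₀ K) : T * lift T c = lift T (tOp δ c) := by
  induction c using Finsupp.induction_linear with
  | zero => simp [lift_zero]
  | add x y hx hy => rw [lift_add, mul_add, hx, hy, _root_.map_add, lift_add]
  | single n b =>
    rw [lift_single, tOp_single, lift_add, lift_single, lift_single, ← mul_assoc,
      operator_mul_scalar hT, add_mul, pow_succ', mul_assoc]

lemma lift_mul_lift (c c' : ℕ →₀ K) : lift T c * lift T c' = lift T (lift (tOp δ) c c') := by
  have ht : ∀ n, T ^ n * lift T c' = lift T ((tOp δ ^ n) c') := by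
    intro n
    induction n with
    | zero => simp
    | succ n ih => rw [pow_succ', mul_assoc, ih, operator_mul_lift hT, pow_succ', end_mul_apply]
  induction c using Finsupp.induction_linear with
  | zero => simp [lift_zero]
  | add x y hx hy => rw [lift_add, add_mul, hx, hy, lift_add, end_add_apply, lift_add]
  | single n b => rw [lift_single, mul_assoc, ht, scalar_mul_lift, lift_single]; rfl

end Lift

/-- The operator of left multiplication by the differential polynomial with coefficients `c`. -/
noncomputable abbrev op (δ : Der K) (c : ℕ →₀ K) : AddMonoid.End (ℕ →₀ K) := lift (tOp δ) c

lemma op_apply_one (δ : Der K) (c : ℕ →₀ K) : op δ c (Finsupp.single 0 1) = c := by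
  have ht : ∀ n, (tOp δ ^ n) (Finsupp.single 0 1) = Finsupp.single n (1 : K) := by
    intro n
    induction n with
    | zero => simp
    | succ n ih =>
      rw [pow_succ', end_mul_apply, ih, tOp_single, δ.map_one]
      simp
  induction c using Finsupp.induction_linear with
  | zero => simp [lift_zero]
  | add x y hx hy => rw [op, lift_add, end_add_apply, ← op, ← op, hx, hy]
  | single n b =>
    rw [op, lift_single, end_mul_apply, ht, scalar_apply]
    simp

lemma op_one (δ : Der K) : op δ (Finsupp.single 0 1) = 1 := by simp [lift_single]

lemma tOp_pow_apply (δ : Der K) {c : ℕ →₀ K} {k : ℕ} (hc : ∀ j, k < j → c j = 0) (n : ℕ) :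
    (∀ j, n + k < j → (tOp δ ^ n) c j = 0) ∧ (tOp δ ^ n) c (n + k) = c k := by
  induction n with
  | zero => simpa using hc
  | succ n ih =>
    rw [pow_succ', end_mul_apply]
    constructor
    · intro j hj
      obtain ⟨j, rfl⟩ : ∃ i, j = i + 1 := ⟨j - 1, by omega⟩
      rw [tOp_apply_succ, ih.1 j (by omega), ih.1 (j + 1) (by omega), δ.map_zero, add_zero]
    · rw [show n + 1 + k = n + k + 1 by ring, tOp_apply_succ, ih.2, ih.1 _ (by omega),
        δ.map_zero, add_zero]

/-- The degree and the leading coefficient are multiplicative. -/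
lemma op_apply (δ : Der K) {c c' : ℕ →₀ K} {n k : ℕ} (hc : ∀ j, n < j → c j = 0)
    (hc' : ∀ j, k < j → c' j = 0) :
    (∀ j, n + k < j → op δ c c' j = 0) ∧ op δ c c' (n + k) = c n * c' k := by
  have hsum : ∀ (c : ℕ →₀ K) j, op δ c c' j = c.sum fun i a => a * (tOp δ ^ i) c' j := by
    intro c j
    induction c using Finsupp.induction_linear with
    | zero => simp [lift_zero]
    | add x y hx hy =>
      rw [Finsupp.sum_add_index' (by simp) (by intros; ring), ← hx, ← hy, op, lift_add]
      rfl
    | single i b => simp [lift_single, end_mul_apply, scalar_apply]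
  have hle : ∀ i ∈ c.support, i ≤ n := fun i hi => by
    by_contra! h
    exact Finsupp.mem_support_iff.1 hi (hc i h)
  constructor
  · intro j hj
    rw [hsum]
    refine Finset.sum_eq_zero fun i hi => ?_
    dsimp only
    rw [(tOp_pow_apply δ hc' i).1 j (by have := hle i hi; omega), mul_zero]
  · rw [hsum, Finsupp.sum, Finset.sum_eq_single n]
    · rw [(tOp_pow_apply δ hc' n).2]
    · intro i hi hin
      rw [(tOp_pow_apply δ hc' i).1 _ (by have := hle i hi; omega), mul_zero]
    · intro hn
      rw [Finsupp.notMem_support_iff.1 hn, zero_mul]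

/-- The ring `K[t;δ]`, realized as a ring of additive operators on its coefficient sequences. -/
noncomputable def ring (δ : Der K) : Subring (AddMonoid.End (ℕ →₀ K)) where
  carrier := Set.range (op δ)
  mul_mem' := by rintro _ _ ⟨c, rfl⟩ ⟨c', rfl⟩; exact ⟨_, (lift_mul_lift (tOp_smul δ) c c').symm⟩
  one_mem' := ⟨_, lift_one _⟩
  add_mem' := by rintro _ _ ⟨c, rfl⟩ ⟨c', rfl⟩; exact ⟨_, lift_add _ c c'⟩
  zero_mem' := ⟨0, lift_zero _⟩
  neg_mem' := by rintro _ ⟨c, rfl⟩; exact ⟨_, lift_neg _ c⟩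

/-- The coefficients of an element of `K[t;δ]`. -/
noncomputable def coeff (δ : Der K) : ring δ →+ (ℕ →₀ K) where
  toFun x := (x : AddMonoid.End (ℕ →₀ K)) (Finsupp.single 0 1)
  map_zero' := rfl
  map_add' _ _ := rfl

lemma op_coeff (δ : Der K) (x : ring δ) : op δ (coeff δ x) = x := by
  obtain ⟨_, c, rfl⟩ := x
  exact congrArg _ (op_apply_one δ c)

lemma coeff_injective (δ : Der K) : Function.Injective (coeff δ) := fun x y h =>
  Subtype.ext (by rw [← op_coeff, h, op_coeff])

lemma coeff_mul (δ : Der K) (x y : ring δ) :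
    coeff δ (x * y) = op δ (coeff δ x) (coeff δ y) := by
  rw [op_coeff]
  rfl

/-- The element of `K[t;δ]` with given coefficients. -/
noncomputable def ofCoeff (δ : Der K) (c : ℕ →₀ K) : ring δ := ⟨op δ c, c, rfl⟩

lemma coeff_ofCoeff (δ : Der K) (c : ℕ →₀ K) : coeff δ (ofCoeff δ c) = c := op_apply_one δ c

lemma support_max_lt_iff (c : ℕ →₀ K) (n : ℕ) :
    c.support.max < (n : WithBot ℕ) ↔ ∀ j, n ≤ j → c j = 0 := by
  have hbot : (⊥ : WithBot ℕ) < (n : WithBot ℕ) := WithBot.bot_lt_coe n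
  rw [Finset.max, Finset.sup_lt_iff hbot]
  constructor
  · intro h j hj
    by_contra hc
    have := h j (Finsupp.mem_support_iff.2 hc)
    exact absurd (WithBot.coe_lt_coe.1 this) (not_lt.2 hj)
  · intro h j hj
    refine WithBot.coe_lt_coe.2 ?_
    by_contra! hc
    exact Finsupp.mem_support_iff.1 hj (h j hc)

lemma exists_support_max_eq {c : ℕ →₀ K} (hc : c ≠ 0) :
    ∃ n : ℕ, c.support.max = n ∧ c n ≠ 0 ∧ ∀ j, n < j → c j = 0 := by
  obtain ⟨n, hn⟩ := Finset.max_of_nonempty (Finsupp.support_nonempty_iff.2 hc)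
  refine ⟨n, hn, Finsupp.mem_support_iff.1 (Finset.mem_of_max hn), fun j hj => ?_⟩
  by_contra h
  exact absurd (Finset.le_max_of_eq (Finsupp.mem_support_iff.2 h) hn) (not_le.2 hj)

lemma exists_rightDiv (δ : Der K) (f x : ring δ) (hf : f ≠ 0) :
    ∃! r : ring δ, (∃ q : ring δ, x = q * f + r) ∧
      (coeff δ r).support.max < (coeff δ f).support.max := by
  have hcf : coeff δ f ≠ 0 := fun h => hf (coeff_injective δ (by rw [h, map_zero]))
  obtain ⟨n, hmax, hlead, hdeg⟩ := exists_support_max_eq hcf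
  simp only [hmax, support_max_lt_iff]
  have hex : ∀ N, ∀ x : ring δ, (∀ j, N ≤ j → coeff δ x j = 0) →
      ∃ r : ring δ, (∃ q : ring δ, x = q * f + r) ∧ ∀ j, n ≤ j → coeff δ r j = 0 := by
    intro N
    induction N with
    | zero => exact fun x hx => ⟨x, ⟨0, by simp⟩, fun j _ => hx j (Nat.zero_le j)⟩
    | succ N ih =>
      intro x hx
      rcases Nat.lt_or_ge N n with h | h
      · exact ⟨x, ⟨0, by simp⟩, fun j hj => hx j (by omega)⟩
      · let q := ofCoeff δ (Finsupp.single (N - n) (coeff δ x N * (coeff δ f n)⁻¹))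
        have hq := op_apply δ (c := coeff δ q) (c' := coeff δ f) (n := N - n) (k := n)
          (by intro j hj; rw [coeff_ofCoeff, Finsupp.single_eq_of_ne (by omega)]) hdeg
        rw [← coeff_mul, Nat.sub_add_cancel h] at hq
        obtain ⟨r, ⟨q', hq'⟩, hr⟩ := ih (x - q * f) (by
          intro j hj
          rw [map_sub, Finsupp.sub_apply]
          rcases hj.lt_or_eq with hj | rfl
          · rw [hx j hj, hq.1 j hj, sub_zero]
          · rw [hq.2, coeff_ofCoeff, Finsupp.single_eq_same, inv_mul_cancel_right₀ hlead,
              sub_self])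
        exact ⟨r, ⟨q + q', by rw [add_mul, add_assoc, ← hq', add_sub_cancel]⟩, hr⟩
  obtain ⟨N, hN⟩ : ∃ N, ∀ j, N ≤ j → coeff δ x j = 0 := by
    rcases eq_or_ne (coeff δ x) 0 with h | h
    · exact ⟨0, by simp [h]⟩
    · obtain ⟨N, -, -, hN⟩ := exists_support_max_eq h
      exact ⟨N + 1, fun j hj => hN j (by omega)⟩
  obtain ⟨r, ⟨q, hq⟩, hr⟩ := hex N x hN
  refine ⟨r, ⟨⟨q, hq⟩, hr⟩, ?_⟩
  rintro r' ⟨⟨q', hq'⟩, hr'⟩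
  have hd : (q - q') * f = r' - r := by
    rw [sub_mul, sub_eq_sub_iff_add_eq_add, ← hq, hq', add_comm]
  have hqq : q - q' = 0 := by
    by_contra hne
    have hcq : coeff δ (q - q') ≠ 0 := fun h => hne (coeff_injective δ (by rw [h, map_zero]))
    obtain ⟨k, -, hk, hkdeg⟩ := exists_support_max_eq hcq
    have h1 := (op_apply δ hkdeg hdeg).2
    rw [← coeff_mul, hd, map_sub, Finsupp.sub_apply, hr _ (by omega), hr' _ (by omega),
      sub_zero] at h1
    exact mul_ne_zero hk hlead h1.symm
  rw [hqq, zero_mul] at hd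
  exact sub_eq_zero.1 hd.symm

end DiffOp

/-- The differential polynomial ring `K[t;δ]`. -/
noncomputable def diffPolyRing (δ : Der K) : DiffPolyRing K δ (DiffOp.ring δ) where
  i := (DiffOp.scalar K (ℕ →₀ K)).codRestrict (DiffOp.ring δ)
    fun a => ⟨Finsupp.single 0 a, by simp [DiffOp.lift_single]⟩
  t := ⟨DiffOp.tOp δ, Finsupp.single 1 1, by simp [DiffOp.lift_single]⟩
  coeff := DiffOp.coeff δ
  t_mul a := Subtype.ext (DiffOp.operator_mul_scalar (DiffOp.tOp_smul δ) a)
  repr' x := by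
    refine Subtype.ext ?_
    rw [← DiffOp.op_coeff, DiffOp.op, DiffOp.lift, Finsupp.sum, Finsupp.sum, AddSubmonoidClass.coe_finsetSum]
    rfl
  coeff_unique x c hx := by
    have : (x : AddMonoid.End (ℕ →₀ K)) = DiffOp.op δ c := by
      refine (congrArg Subtype.val hx).trans ?_
      rw [Finsupp.sum, AddSubmonoidClass.coe_finsetSum]
      rfl
    rw [← DiffOp.op_apply_one δ c, ← this]
    rfl
  rightDiv f x hf := DiffOp.exists_rightDiv δ f x hf

namespace DiffPolyRing

variable {δ : Der K} {R : Type} [Ring R] (D : DiffPolyRing K δ R)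

lemma coeff_monomial (n : ℕ) (a : K) :
    D.coeff (D.i a * D.t ^ n) = Finsupp.single n a :=
  (D.coeff_unique _ _ (by simp)).symm

lemma coeff_injective : Function.Injective D.coeff := fun x y h => by
  rw [D.repr' x, D.repr' y, h]

lemma induction {P : R → Prop} (x : R) (hadd : ∀ x y, P x → P y → P (x + y))
    (hmon : ∀ n a, P (D.i a * D.t ^ n)) : P x := by
  have h0 : P 0 := by simpa using hmon 0 0
  rw [D.repr' x]
  exact Finset.sum_induction _ P hadd h0 fun n _ => hmon n _

lemma coeff_t_mul (x : R) : D.coeff (D.t * x) = DiffOp.tOp δ (D.coeff x) := by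
  induction x using D.induction with
  | hadd x y hx hy => rw [mul_add, D.coeff_add, hx, hy, D.coeff_add, map_add]
  | hmon n a =>
    rw [D.coeff_monomial, DiffOp.tOp_single, ← mul_assoc, D.t_mul, add_mul, mul_assoc, ← pow_succ',
      D.coeff_add, D.coeff_monomial, D.coeff_monomial]

section Action

variable {V : Type*} [AddCommGroup V] [Module K V] {T : AddMonoid.End V}
  (hT : ∀ (a : K) v, T (a • v) = a • T v + δ.toFun a • v)

/-- A pseudo-linear map `T` on a `K`-space makes it a module over `K[t;δ]`. -/
noncomputable def act : R →+* AddMonoid.End V where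
  toFun x := DiffOp.lift T (D.coeff x)
  map_zero' := by rw [D.coeff_zero, DiffOp.lift_zero]
  map_add' x y := by rw [D.coeff_add, DiffOp.lift_add]
  map_one' := by
    have := D.coeff_monomial 0 1
    rw [map_one, pow_zero, mul_one] at this
    rw [this, DiffOp.lift_one]
  map_mul' x y := by
    induction x using D.induction with
    | hadd x y hx hy => rw [add_mul, D.coeff_add, D.coeff_add, DiffOp.lift_add, DiffOp.lift_add,
        add_mul, hx, hy]
    | hmon n a =>
      rw [D.coeff_monomial, DiffOp.lift_single, mul_assoc, D.coeff_smul, ← DiffOp.scalar_mul_lift,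
        mul_assoc]
      congr 1
      induction n with
      | zero => simp
      | succ n ih =>
        rw [pow_succ', mul_assoc, D.coeff_t_mul, ← DiffOp.operator_mul_lift hT, ih, pow_succ',
          mul_assoc]

lemma act_i (a : K) (v : V) : D.act hT (D.i a) v = a • v := by
  have := D.coeff_monomial 0 a
  rw [pow_zero, mul_one] at this
  change DiffOp.lift T (D.coeff (D.i a)) v = _
  rw [this, DiffOp.lift_single, pow_zero, mul_one]
  rfl

lemma act_t : D.act hT D.t = T := by
  have := D.coeff_monomial 1 1
  rw [map_one, pow_one, one_mul] at this
  change DiffOp.lift T (D.coeff D.t) = _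
  rw [this, DiffOp.lift_single, pow_one, map_one, one_mul]

end Action

lemma coeff_mul_op (x y : R) :
    D.coeff (x * y) = DiffOp.op δ (D.coeff x) (D.coeff y) := by
  have h1 : ∀ z, D.act (DiffOp.tOp_smul δ) z (Finsupp.single 0 1) = D.coeff z := fun z =>
    DiffOp.op_apply_one δ _
  rw [← h1 (x * y), map_mul, DiffOp.end_mul_apply, h1]
  rfl

lemma mem_SfSet_iff {m : ℕ} {x : R} : x ∈ D.SfSet m ↔ ∀ j, m ≤ j → D.coeff x j = 0 :=
  DiffOp.support_max_lt_iff _ _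

end DiffPolyRing
end Construction

section Cyclic

variable {F K : Type} [Field F] [Field K] [Algebra F K] {δ : Der K} {V : Type*} [AddCommGroup V]
  [Module K V] {T : AddMonoid.End V}

lemma Der.HasConstants.apply_algebraMap (hδ : δ.HasConstants F) (c : F) :
    δ.toFun (algebraMap F K c) = 0 := (hδ _).2 ⟨c, rfl⟩

/-- A derivation as a linear map over its constants. -/
def Der.toLinearMap (hδ : δ.HasConstants F) : K →ₗ[F] K where
  toFun := δ.toFun
  map_add' := δ.map_add'
  map_smul' c a := by
    rw [Algebra.smul_def, δ.leibniz', hδ.apply_algebraMap, zero_mul, add_zero, RingHom.id_apply,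
      Algebra.smul_def]

lemma Der.toLinearMap_pow (hδ : δ.HasConstants F) (n : ℕ) (a : K) :
    (Der.toLinearMap hδ ^ n) a = δ.toFun^[n] a := by
  rw [Module.End.pow_apply]
  rfl

lemma pow_apply_succ (T : AddMonoid.End V) (n : ℕ) (v : V) : (T ^ (n + 1)) v = T ((T ^ n) v) := by
  rw [pow_succ']
  rfl

/-- The Leibniz expansion of the powers of a pseudo-linear map. -/
lemma exists_leibniz_expansion
    (hT : ∀ (a : K) v, T (a • v) = a • T v + δ.toFun a • v) (v : V) (n : ℕ) :
    ∃ w : ℕ → V, w n = v ∧ (∀ i, n < i → w i = 0) ∧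
      ∀ a : K, (T ^ n) (a • v) = ∑ i ∈ Finset.range (n + 1), δ.toFun^[i] a • w i := by
  induction n with
  | zero => exact ⟨Pi.single 0 v, by simp, fun i hi => by simp [Nat.ne_of_gt hi],
    by simp⟩
  | succ n ih =>
    obtain ⟨w, hw, hw0, hexp⟩ := ih
    refine ⟨fun i => T (w i) + if i = 0 then 0 else w (i - 1), ?_, ?_, ?_⟩
    · simp [hw0 (n + 1) (by omega), hw]
    · intro i hi
      simp [hw0 i (by omega), hw0 (i - 1) (by omega)]
    · intro a
      rw [pow_apply_succ, hexp, map_sum]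
      simp only [hT, smul_add, Finset.sum_add_distrib]
      congr 1
      · rw [Finset.sum_range_succ _ (n + 1), hw0 (n + 1) (by omega), map_zero, smul_zero, add_zero]
      · rw [Finset.sum_range_succ' _ (n + 1)]
        simp [Function.iterate_succ_apply']

/-- A monic differential operator of order less than `[K:F]` does not vanish on a line. -/
lemma exists_functional_apply_ne_zero [FiniteDimensional F K] (hδ : δ.HasConstants F)
    (hT : ∀ (a : K) v, T (a • v) = a • T v + δ.toFun a • v) {n : ℕ}
    (hn : n < Module.finrank F K) (c : Fin n → K) (l : V →ₗ[K] K) {v : V} (hv : l v ≠ 0) :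
    ∃ a : K, l ((T ^ n) (a • v) - ∑ i : Fin n, c i • (T ^ (i : ℕ)) (a • v)) ≠ 0 := by
  choose w hw hw0 hexp using exists_leibniz_expansion hT v
  by_contra! h
  refine hv ?_
  have key := leading_coeff_eq_zero_of_operator_eq_zero (Der.toLinearMap hδ) δ.leibniz'
    (fun a ha => (hδ a).1 ha) n hn (fun j => l (w n j) - ∑ i : Fin n, c i * l (w i j)) ?_
  · rw [hw, Finset.sum_eq_zero fun i _ => by rw [hw0 i n i.2, map_zero, mul_zero], sub_zero] at key
    exact key
  · intro a
    have hext : ∀ i : Fin n, (T ^ (i : ℕ)) (a • v) =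
        ∑ j ∈ Finset.range (n + 1), δ.toFun^[j] a • w i j := fun i => by
      rw [hexp]
      refine Finset.sum_subset (Finset.range_mono (by omega)) fun j _ hj => ?_
      rw [hw0 i j (by simpa using hj), smul_zero]
    rw [← h a, hexp]
    simp only [hext, Der.toLinearMap_pow, map_sub, map_sum, map_smul, smul_eq_mul, sub_mul,
      Finset.sum_sub_distrib, Finset.mul_sum, Finset.sum_mul]
    congr 1
    · exact Finset.sum_congr rfl fun _ _ => mul_comm _ _
    · rw [Finset.sum_comm]
      exact Finset.sum_congr rfl fun _ _ => Finset.sum_congr rfl fun _ _ => by ring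

open Classical in
/-- Linear independence is an open condition. -/
lemma exists_linearIndependent_add_smul [Infinite F] {n : ℕ} (x y : Fin n → V)
    (hx : LinearIndependent K x) :
    ∃ c : F, c ≠ 0 ∧ LinearIndependent K (fun i => x i + algebraMap F K c • y i) := by
  obtain ⟨g, hg⟩ := LinearMap.exists_leftInverse_of_injective (Fintype.linearCombination K x)
    (LinearMap.ker_eq_bot.2 (hx.fintypeLinearCombination_injective))
  have hgx : ∀ i, g (x i) = Pi.single i 1 := fun i => by
    simpa using LinearMap.congr_fun hg (Pi.single i 1)
  let M : Matrix (Fin n) (Fin n) K := Matrix.of fun i => -g (y i)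
  have hM : M.charpolyRev ≠ 0 := fun h => by
    have := M.eval_charpolyRev
    rw [h] at this
    simp at this
  obtain ⟨c, hc⟩ := Set.Infinite.nonempty (Set.Finite.infinite_compl
    (s := (algebraMap F K) ⁻¹' (insert 0 (M.charpolyRev.roots.toFinset : Set K)))
    (Set.Finite.preimage (algebraMap F K).injective.injOn (Set.Finite.insert 0 (Finset.finite_toSet _))))
  simp only [Set.mem_compl_iff, Set.mem_preimage, Set.mem_insert_iff, Finset.mem_coe,
    Multiset.mem_toFinset, Polynomial.mem_roots hM, not_or] at hc
  refine ⟨c, fun h => hc.1 (by rw [h, map_zero]), LinearIndependent.of_comp g ?_⟩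
  have hdet : (1 - algebraMap F K c • M).det ≠ 0 := by
    intro h
    refine hc.2 ?_
    rw [Polynomial.IsRoot, Matrix.charpolyRev, ← h, ← Polynomial.coe_evalRingHom, RingHom.map_det]
    congr 1
    ext i j
    rcases eq_or_ne i j with rfl | hij <;> simp [*] <;> rw [Algebra.smul_def, mul_comm]
  have hrow : (g ∘ fun i => x i + algebraMap F K c • y i) = (1 - algebraMap F K c • M).row := by
    ext i j
    simp [hgx, M, Matrix.one_apply, Pi.single_apply, eq_comm]
  rw [hrow]
  exact Matrix.linearIndependent_rows_of_det_ne_zero hdet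

/-- A pseudo-linear map on a space of dimension at most `[K:F]` has a cyclic vector. -/
lemma exists_cyclic_vector [Infinite F] [FiniteDimensional F K] [FiniteDimensional K V] (hδ : δ.HasConstants F)
    (hT : ∀ (a : K) v, T (a • v) = a • T v + δ.toFun a • v)
    (hV : Module.finrank K V ≤ Module.finrank F K) :
    ∃ v : V, LinearIndependent K (fun i : Fin (Module.finrank K V) => (T ^ (i : ℕ)) v) := by
  have key : ∀ r ≤ Module.finrank K V,
      ∃ v : V, LinearIndependent K (fun i : Fin r => (T ^ (i : ℕ)) v) := by
    intro r
    induction r with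
    | zero => exact fun _ => ⟨0, linearIndependent_empty_type⟩
    | succ r ih =>
      intro hr
      obtain ⟨v, hv⟩ := ih (by omega)
      have hsnoc : ∀ v : V, (fun i : Fin (r + 1) => (T ^ (i : ℕ)) v) =
          Fin.snoc (fun i : Fin r => (T ^ (i : ℕ)) v) ((T ^ r) v) := fun v => by
        ext i
        refine Fin.lastCases ?_ (fun i => ?_) i <;> simp
      simp only [hsnoc, linearIndependent_finSnoc]
      by_cases hmem : (T ^ r) v ∈ Submodule.span K (Set.range fun i : Fin r => (T ^ (i : ℕ)) v)
      swap
      · exact ⟨v, hv, hmem⟩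
      obtain ⟨c, hc⟩ := (Submodule.mem_span_range_iff_exists_fun K).1 hmem
      obtain ⟨l, hl, hle⟩ := Submodule.exists_le_ker_of_lt_top
        (Submodule.span K (Set.range fun i : Fin r => (T ^ (i : ℕ)) v)) (by
          refine lt_top_iff_ne_top.2 fun h => ?_
          have := finrank_range_le_card (R := K) fun i : Fin r => (T ^ (i : ℕ)) v
          rw [Set.finrank, h, finrank_top, Fintype.card_fin] at this
          omega)
      obtain ⟨w, hw⟩ : ∃ w, l w ≠ 0 := by
        by_contra! h
        exact hl (LinearMap.ext h)
      obtain ⟨a, ha⟩ := exists_functional_apply_ne_zero hδ hT (n := r) (by omega) c l hw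
      set u := (T ^ r) (a • w) - ∑ i : Fin r, c i • (T ^ (i : ℕ)) (a • w) with hu
      have hind : LinearIndependent K
          (Fin.snoc (fun i : Fin r => (T ^ (i : ℕ)) v) u : Fin (r + 1) → V) :=
        linearIndependent_finSnoc.2 ⟨hv, fun h => ha (LinearMap.mem_ker.1 (hle h))⟩
      obtain ⟨d, hd, hind'⟩ := exists_linearIndependent_add_smul (F := F) _
        (Fin.snoc (fun i : Fin r => (T ^ (i : ℕ)) (a • w)) 0 : Fin (r + 1) → V) hind
      have hTd : ∀ n x, (T ^ n) (algebraMap F K d • x) = algebraMap F K d • (T ^ n) x := by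
        intro n x
        induction n with
        | zero => rfl
        | succ n ih =>
          rw [pow_apply_succ, ih, hT, hδ.apply_algebraMap, zero_smul, add_zero, pow_apply_succ]
      have hfam : (fun i : Fin (r + 1) =>
          (Fin.snoc (fun i : Fin r => (T ^ (i : ℕ)) v) u : Fin (r + 1) → V) i + algebraMap F K d •
            (Fin.snoc (fun i : Fin r => (T ^ (i : ℕ)) (a • w)) 0 : Fin (r + 1) → V) i) =
          (Fin.snoc (fun i : Fin r => (T ^ (i : ℕ)) (v + algebraMap F K d • a • w)) u :
            Fin (r + 1) → V) := by
        ext i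
        refine Fin.lastCases ?_ (fun i => ?_) i
        · simp
        · simp only [Fin.snoc_castSucc, map_add, hTd]
      rw [hfam, linearIndependent_finSnoc] at hind'
      refine ⟨_, hind'.1, fun h => hind'.2 ?_⟩
      have hdu : algebraMap F K d • u = (T ^ r) (v + algebraMap F K d • a • w) -
          ∑ i : Fin r, c i • (T ^ (i : ℕ)) (v + algebraMap F K d • a • w) := by
        simp only [map_add, hTd, smul_add, Finset.sum_add_distrib, hc]
        rw [add_sub_add_left_eq_sub, hu, smul_sub, Finset.smul_sum]
        simp only [smul_comm (algebraMap F K d) (c _)]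
      rw [← Submodule.smul_mem_iff _ ((map_ne_zero (algebraMap F K)).2 hd), hdu]
      exact Submodule.sub_mem _ h
        (Submodule.sum_mem _ fun i _ => Submodule.smul_mem _ _ (Submodule.subset_span ⟨i, rfl⟩))
  exact key _ le_rfl

end Cyclic

section Splitting

variable {F K B : Type} [Field F] [Field K] [Algebra F K] [Ring B] [Algebra F B] {δ : Der K}
  (hδ : δ.HasConstants F)

/-- The extension of a derivation of `K` to `K ⊗ B` killing `B`. -/
noncomputable def tensorDer (B : Type) [Ring B] [Algebra F B] : K ⊗[F] B →ₗ[F] K ⊗[F] B :=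
  LinearMap.rTensor B (Der.toLinearMap hδ)

lemma tensorDer_tmul (a : K) (b : B) : tensorDer hδ B (a ⊗ₜ b) = δ.toFun a ⊗ₜ b := rfl

lemma tensorDer_mul (x y : K ⊗[F] B) :
    tensorDer hδ B (x * y) = tensorDer hδ B x * y + x * tensorDer hδ B y := by
  induction x using TensorProduct.induction_on with
  | zero => simp
  | add x x' hx hx' => simp only [add_mul, map_add, hx, hx']; abel
  | tmul a b =>
    induction y using TensorProduct.induction_on with
    | zero => simp
    | add y y' hy hy' => simp only [mul_add, map_add, hy, hy']; abel
    | tmul a' b' =>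
      simp only [Algebra.TensorProduct.tmul_mul_tmul, tensorDer_tmul, δ.leibniz',
        TensorProduct.add_tmul]
      rw [add_comm]

lemma tensorDer_smul (a : K) (x : K ⊗[F] B) :
    tensorDer hδ B (a • x) = a • tensorDer hδ B x + δ.toFun a • x := by
  have h := tensorDer_mul hδ (algebraMap K (K ⊗[F] B) a) x
  rw [Algebra.TensorProduct.algebraMap_apply, Algebra.algebraMap_self_apply, tensorDer_tmul] at h
  simp only [Algebra.smul_def, Algebra.TensorProduct.algebraMap_apply,
    Algebra.algebraMap_self_apply]
  rw [h, add_comm]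

lemma tensorDer_eq_zero_iff (x : K ⊗[F] B) :
    tensorDer hδ B x = 0 ↔ ∃ b : B, 1 ⊗ₜ b = x := by
  have hex : Function.Exact (Algebra.linearMap F K) (Der.toLinearMap hδ) := fun a => by
    exact hδ a
  refine (Module.Flat.rTensor_exact B hex x).trans ⟨?_, ?_⟩
  · rintro ⟨y, rfl⟩
    refine ⟨TensorProduct.lid F B y, ?_⟩
    induction y using TensorProduct.induction_on with
    | zero => simp
    | add y y' hy hy' => rw [map_add, TensorProduct.tmul_add, hy, hy', map_add]
    | tmul c b =>
      rw [TensorProduct.lid_tmul, LinearMap.rTensor_tmul, ← TensorProduct.smul_tmul,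
        Algebra.linearMap_apply, Algebra.algebraMap_eq_smul_one]
  · rintro ⟨b, rfl⟩
    exact ⟨1 ⊗ₜ b, by simp⟩

include hδ in
/-- If `K` splits `B`, the opposite of `B` is the algebra of endomorphisms of a `K`-space commuting
with a pseudo-linear map. -/
lemma exists_pseudoLinear {m : ℕ} (hm : 0 < m)
    (Φ : (K ⊗[F] B) ≃ₐ[K] Matrix (Fin m) (Fin m) K) :
    ∃ (T : AddMonoid.End (Fin m → K)) (ρ : B →+ Module.End K (Fin m → K)),
      (∀ (a : K) v, T (a • v) = a • T v + δ.toFun a • v) ∧ (∀ b c, ρ (b * c) = ρ c * ρ b) ∧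
      (∀ c v, ρ (algebraMap F B c) v = algebraMap F K c • v) ∧ Function.Injective ρ ∧
      ∀ M : Module.End K (Fin m → K), (∀ v, M (T v) = T (M v)) ↔ ∃ b, ρ b = M := by
  let ψ : (K ⊗[F] B) ≃ₗ[K] Module.End K (Fin m → K) :=
    Φ.toLinearEquiv ≪≫ₗ Matrix.transposeLinearEquiv (Fin m) (Fin m) K K ≪≫ₗ Matrix.toLin'
  have hψ : ∀ x, ψ x = Matrix.toLin' (Φ x).transpose := fun _ => rfl
  have hψmul : ∀ x y, ψ (x * y) = ψ y * ψ x := fun x y => by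
    rw [hψ, map_mul, Matrix.transpose_mul, Matrix.toLin'_mul]
    rfl
  let D : Module.End K (Fin m → K) →+ Module.End K (Fin m → K) :=
    (ψ.toLinearMap.toAddMonoidHom.comp (tensorDer hδ B).toAddMonoidHom).comp
      ψ.symm.toLinearMap.toAddMonoidHom
  have hD : ∀ x, D (ψ x) = ψ (tensorDer hδ B x) := fun x => by
    change ψ (tensorDer hδ B (ψ.symm (ψ x))) = _
    rw [ψ.symm_apply_apply]
  have hDmul : ∀ M N, D (M * N) = D M * N + M * D N := fun M N => by
    obtain ⟨x, rfl⟩ := ψ.surjective M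
    obtain ⟨y, rfl⟩ := ψ.surjective N
    rw [← hψmul, hD, hD, hD, tensorDer_mul, map_add, hψmul, hψmul, add_comm]
  have hDsmul : ∀ (a : K) M, D (a • M) = a • D M + δ.toFun a • M := fun a M => by
    obtain ⟨x, rfl⟩ := ψ.surjective M
    rw [← map_smul, hD, hD, tensorDer_smul, map_add, map_smul, map_smul]
  have hDzero : ∀ M, D M = 0 ↔ ∃ b : B, ψ (1 ⊗ₜ b) = M := fun M => by
    obtain ⟨x, rfl⟩ := ψ.surjective M
    simp only [hD, ψ.map_eq_zero_iff, ψ.injective.eq_iff, tensorDer_eq_zero_iff]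
  let i₀ : Fin m := ⟨0, hm⟩
  let E : (Fin m → K) → Module.End K (Fin m → K) := fun v => (LinearMap.proj i₀).smulRight v
  have hEadd : ∀ v w, E (v + w) = E v + E w := fun v w => LinearMap.ext fun x => smul_add _ _ _
  have hEmul : ∀ (M : Module.End K (Fin m → K)) v, E (M v) = M * E v := fun M v =>
    LinearMap.ext fun x => (map_smul M _ _).symm
  have hEone : ∀ v, E v (Pi.single i₀ 1) = v := fun v => by simp [E]
  let T : AddMonoid.End (Fin m → K) := AddMonoidHom.mk' (fun v => D (E v) (Pi.single i₀ 1))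
    fun v w => by rw [hEadd, map_add, LinearMap.add_apply]
  have hTmul : ∀ (M : Module.End K (Fin m → K)) v, T (M v) = D M v + M (T v) := fun M v => by
    change D (E (M v)) _ = _ + M (D (E v) _)
    rw [hEmul, hDmul, LinearMap.add_apply, Module.End.mul_apply, Module.End.mul_apply, hEone]
  have hψone : ψ 1 = 1 := by rw [hψ, map_one, Matrix.transpose_one, Matrix.toLin'_one]; rfl
  have hDone : D 1 = 0 := (hDzero 1).2 ⟨1, by rw [← Algebra.TensorProduct.one_def, hψone]⟩
  let ρ : B →+ Module.End K (Fin m → K) := AddMonoidHom.mk' (fun b => ψ (1 ⊗ₜ b))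
    fun b c => by rw [TensorProduct.tmul_add, map_add]
  have hρ : ∀ b, ρ b = ψ (1 ⊗ₜ b) := fun _ => rfl
  refine ⟨T, ρ, fun a v => ?_, fun b c => ?_, fun c v => ?_, fun b c h => ?_, fun M => ?_⟩
  · have := hTmul (a • 1) v
    rw [hDsmul, hDone, smul_zero, zero_add, add_comm] at this
    exact this
  · rw [hρ, hρ, hρ, ← hψmul, Algebra.TensorProduct.tmul_mul_tmul, one_mul]
  · rw [hρ, Algebra.algebraMap_eq_smul_one, ← TensorProduct.smul_tmul,
      ← Algebra.algebraMap_eq_smul_one, ← mul_one (algebraMap F K c), ← smul_eq_mul,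
      ← TensorProduct.smul_tmul', map_smul, ← Algebra.TensorProduct.one_def, hψone]
    simp
  · exact Algebra.TensorProduct.includeRight_injective (algebraMap F K).injective
      (ψ.injective h)
  · simp only [hρ, ← hDzero, hTmul, right_eq_add]
    exact (LinearMap.ext_iff (f := D M) (g := 0)).symm

end Splitting

namespace DiffPolyRing

section Basic

variable {K : Type} [Field K] {δ : Der K} {R : Type} [Ring R] (D : DiffPolyRing K δ R)

/-- The coefficients of a differential polynomial, as an additive map. -/
noncomputable def coeffHom : R →+ (ℕ →₀ K) := AddMonoidHom.mk' D.coeff D.coeff_add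

lemma coeff_sub (x y : R) : D.coeff (x - y) = D.coeff x - D.coeff y := D.coeffHom.map_sub x y

lemma coeff_t_pow (n : ℕ) : D.coeff (D.t ^ n) = Finsupp.single n 1 := by
  simpa using D.coeff_monomial n 1

lemma coeff_i (a : K) : D.coeff (D.i a) = Finsupp.single 0 a := by
  simpa using D.coeff_monomial 0 a

/-- The differential polynomial with the given coefficients below `m`. -/
def ofFn {m : ℕ} (c : Fin m → K) : R := ∑ j : Fin m, D.i (c j) * D.t ^ (j : ℕ)

lemma coeff_ofFn {m : ℕ} (c : Fin m → K) : (∀ j, D.coeff (D.ofFn c) (j : Fin m) = c j) ∧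
    ∀ j, m ≤ j → D.coeff (D.ofFn c) j = 0 := by
  have h : ∀ k, D.coeff (D.ofFn c) k = ∑ j : Fin m, Finsupp.single (j : ℕ) (c j) k := fun k => by
    have := map_sum D.coeffHom (fun j : Fin m => D.i (c j) * D.t ^ (j : ℕ)) Finset.univ
    change D.coeff (D.ofFn c) = ∑ j : Fin m, D.coeff _ at this
    rw [this, Finsupp.finsetSum_apply]
    simp only [coeff_monomial]
  constructor
  · intro j
    rw [h, Finset.sum_eq_single j, Finsupp.single_eq_same]
    · exact fun k _ hk => Finsupp.single_eq_of_ne fun h => hk (Fin.ext h.symm)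
    · simp
  · intro k hk
    rw [h]
    exact Finset.sum_eq_zero fun j _ => Finsupp.single_eq_of_ne (by omega)

lemma ofFn_mem {m : ℕ} (c : Fin m → K) : D.ofFn c ∈ D.SfSet m :=
  D.mem_SfSet_iff.2 (D.coeff_ofFn c).2

lemma ofFn_coeff {m : ℕ} {x : R} (hx : x ∈ D.SfSet m) :
    D.ofFn (fun j : Fin m => D.coeff x j) = x := by
  refine D.coeff_injective (Finsupp.ext fun j => ?_)
  rcases lt_or_ge j m with h | h
  · exact (D.coeff_ofFn fun j : Fin m => D.coeff x j).1 ⟨j, h⟩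
  · rw [(D.coeff_ofFn _).2 j h, D.mem_SfSet_iff.1 hx j h]

lemma t_pow_mem {m n : ℕ} (h : n < m) : D.t ^ n ∈ D.SfSet m :=
  D.mem_SfSet_iff.2 fun j hj => by rw [coeff_t_pow, Finsupp.single_eq_of_ne (by omega)]

lemma i_mem {m : ℕ} (h : 0 < m) (a : K) : D.i a ∈ D.SfSet m :=
  D.mem_SfSet_iff.2 fun j hj => by rw [coeff_i, Finsupp.single_eq_of_ne (by omega)]

lemma i_mul_mem {m : ℕ} {x : R} (hx : x ∈ D.SfSet m) (a : K) : D.i a * x ∈ D.SfSet m :=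
  D.deg_i_mul_lt a hx

lemma mul_i_mem {m : ℕ} {x : R} (hx : x ∈ D.SfSet m) (a : K) : x * D.i a ∈ D.SfSet m := by
  rw [mem_SfSet_iff] at hx ⊢
  rcases m with _ | m
  · have : x = 0 := D.coeff_injective (Finsupp.ext fun j => by rw [hx j (Nat.zero_le j), coeff_zero]; rfl)
    intro j _
    rw [this, zero_mul, coeff_zero]
    rfl
  · intro j hj
    rw [coeff_mul_op]
    exact (DiffOp.op_apply δ (k := 0) hx
      (by intro j hj; rw [coeff_i, Finsupp.single_eq_of_ne (by omega)])).1 j hj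

lemma sub_mem {m : ℕ} {x y : R} (hx : x ∈ D.SfSet m) (hy : y ∈ D.SfSet m) : x - y ∈ D.SfSet m :=
  (D.res m).sub_mem hx hy

lemma add_mem {m : ℕ} {x y : R} (hx : x ∈ D.SfSet m) (hy : y ∈ D.SfSet m) : x + y ∈ D.SfSet m :=
  (D.res m).add_mem hx hy

lemma finrank_Rlt {F : Type} [Field F] [Algebra F K] [FiniteDimensional F K] (m : ℕ) :
    Module.finrank F (D.Rlt m) = m * Module.finrank F K := by
  let g : D.Rlt m →ₗ[F] (Fin m → K) :=
    { toFun := fun x j => D.coeff x j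
      map_add' := fun x y => by
        ext j
        simp [D.coeff_add]
      map_smul' := fun c x => by
        ext j
        simp [smul_coe, D.coeff_smul, Algebra.smul_def] }
  have hg : Function.Bijective g := by
    constructor
    · intro x y h
      refine Subtype.ext ?_
      rw [← D.ofFn_coeff x.2, ← D.ofFn_coeff y.2]
      exact congrArg D.ofFn h
    · exact fun c => ⟨⟨D.ofFn c, D.ofFn_mem c⟩, funext (D.coeff_ofFn c).1⟩
  rw [(LinearEquiv.ofBijective g hg).finrank_eq, Module.finrank_pi_fintype]
  simp

/-- Constants are central. -/
lemma mul_i_of_constant {a : K} (ha : δ.toFun a = 0) (x : R) : x * D.i a = D.i a * x := by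
  have ht : Commute D.t (D.i a) := by
    have := D.t_mul a
    rwa [ha, map_zero, add_zero] at this
  induction x using D.induction with
  | hadd x y hx hy => rw [add_mul, hx, hy, mul_add]
  | hmon n b =>
    rw [mul_assoc, (ht.pow_left n).eq, ← mul_assoc, ← mul_assoc, ← map_mul, mul_comm, map_mul]

end Basic

/-- A differential polynomial is monic of degree `m`. -/
structure IsMonic {K : Type} [Field K] {δ : Der K} {R : Type} [Ring R] (D : DiffPolyRing K δ R)
    (f : R) (m : ℕ) : Prop where
  coeff_eq_one : D.coeff f m = 1
  coeff_eq_zero : ∀ j, m < j → D.coeff f j = 0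

namespace IsMonic

variable {K : Type} [Field K] {δ : Der K} {R : Type} [Ring R] {D : DiffPolyRing K δ R} {f : R}
  {m : ℕ} (hf : D.IsMonic f m)
include hf

lemma ne_zero : f ≠ 0 := by
  rintro rfl
  have := hf.coeff_eq_one
  rw [D.coeff_zero] at this
  exact zero_ne_one this

lemma deg_eq : D.deg f = m := by
  have hne : D.coeff f ≠ 0 := fun h => by
    have := hf.coeff_eq_one
    rw [h] at this
    exact zero_ne_one this
  obtain ⟨n, hn, hn0, hlt⟩ := DiffOp.exists_support_max_eq hne
  rw [deg, hn]
  congr 1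
  refine le_antisymm ?_ ?_
  · by_contra! h
    exact hn0 (hf.coeff_eq_zero n h)
  · by_contra! h
    have := hf.coeff_eq_one
    rw [hlt m h] at this
    exact zero_ne_one this

lemma modr_spec (x : R) : (∃ q, x = q * f + D.modr f x) ∧ D.modr f x ∈ D.SfSet m := by
  have h := D.rightDiv f x hf.ne_zero
  rw [modr, dif_pos h, SfSet, Set.mem_ofPred_eq, ← hf.deg_eq]
  exact h.choose_spec.1

lemma modr_eq {x q r : R} (hx : x = q * f + r) (hr : r ∈ D.SfSet m) : D.modr f x = r := by
  have h := D.rightDiv f x hf.ne_zero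
  rw [modr, dif_pos h]
  refine (h.choose_spec.2 r ⟨⟨q, hx⟩, ?_⟩).symm
  rw [SfSet, Set.mem_ofPred_eq, ← hf.deg_eq] at hr
  exact hr

lemma modr_of_mem {x : R} (hx : x ∈ D.SfSet m) : D.modr f x = x :=
  hf.modr_eq (q := 0) (by simp) hx

lemma modr_mem (x : R) : D.modr f x ∈ D.SfSet m := (hf.modr_spec x).2

lemma modr_of_degree_le {x : R} (hx : ∀ j, m < j → D.coeff x j = 0) :
    x = D.i (D.coeff x m) * f + D.modr f x := by
  have : x - D.i (D.coeff x m) * f ∈ D.SfSet m := by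
    refine D.mem_SfSet_iff.2 fun j hj => ?_
    rw [coeff_sub, coeff_smul, Finsupp.sub_apply, Finsupp.smul_apply, smul_eq_mul]
    rcases hj.lt_or_eq with hj | rfl
    · rw [hx j hj, hf.coeff_eq_zero j hj, mul_zero, sub_zero]
    · rw [hf.coeff_eq_one, mul_one, sub_self]
  rw [hf.modr_eq (add_sub_cancel (D.i (D.coeff x m) * f) x).symm this, add_sub_cancel]

lemma petitUnital (hm : 0 < m) : D.PetitUnital f m := by
  refine ⟨by simpa using D.i_mem hm 1, fun x hx => ?_⟩
  rw [pmul, pmul, one_mul, mul_one, hf.modr_of_mem hx]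
  exact ⟨rfl, rfl⟩

end IsMonic

/-- A presentation of a module over `K[t;δ]` as the cyclic module `K[t;δ]/K[t;δ]f`, with `f` monic
of degree `m`. -/
structure CyclicPresentation {K : Type} [Field K] {δ : Der K} {R : Type} [Ring R]
    (D : DiffPolyRing K δ R) (f : R) (m : ℕ) (V : Type*) [AddCommGroup V] [Module K V] where
  monic : D.IsMonic f m
  act : R →+* AddMonoid.End V
  act_i : ∀ a v, act (D.i a) v = a • v
  gen : V
  act_gen : act f gen = 0
  eq_zero : ∀ x ∈ D.SfSet m, act x gen = 0 → x = 0
  exists_act_eq : ∀ v, ∃ x ∈ D.SfSet m, act x gen = v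

namespace CyclicPresentation

variable {K : Type} [Field K] {δ : Der K} {R : Type} [Ring R] {D : DiffPolyRing K δ R} {f : R}
  {m : ℕ} {V : Type*} [AddCommGroup V] [Module K V] (P : D.CyclicPresentation f m V)

lemma act_mul (x y : R) (v : V) : P.act (x * y) v = P.act x (P.act y v) := by
  rw [map_mul]
  rfl

lemma act_add (x y : R) (v : V) : P.act (x + y) v = P.act x v + P.act y v := by
  rw [map_add]
  rfl

lemma act_sub (x y : R) (v : V) : P.act (x - y) v = P.act x v - P.act y v := by
  rw [map_sub]
  rfl

lemma act_modr {x : R} {v : V} (hv : P.act f v = 0) : P.act (D.modr f x) v = P.act x v := by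
  obtain ⟨q, hq⟩ := (P.monic.modr_spec x).1
  conv_rhs => rw [hq, act_add, act_mul, hv, map_zero, zero_add]

lemma eq_of_act_gen {x y : R} (hx : x ∈ D.SfSet m) (hy : y ∈ D.SfSet m)
    (h : P.act x P.gen = P.act y P.gen) : x = y :=
  sub_eq_zero.1 (P.eq_zero _ (D.sub_mem hx hy) (by rw [act_sub, h, sub_self]))

lemma act_eq_zero_of_act_gen {y : R} (hy : P.act y P.gen = 0) {v : V} (hv : P.act f v = 0) :
    P.act y v = 0 := by
  rw [← P.act_modr hv, P.eq_zero _ (P.monic.modr_mem y) (by rw [P.act_modr P.act_gen, hy]), map_zero]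
  rfl

lemma pmul_pmul_left (x y z : R) : P.act (D.pmul f (D.pmul f x y) z) P.gen =
    P.act (D.modr f (x * y)) (P.act z P.gen) := by
  rw [pmul, P.act_modr P.act_gen, act_mul, pmul]

lemma pmul_pmul_right (x y z : R) : P.act (D.pmul f x (D.pmul f y z)) P.gen =
    P.act (x * y) (P.act z P.gen) := by
  rw [pmul, P.act_modr P.act_gen, act_mul, pmul, P.act_modr P.act_gen, act_mul, act_mul]

lemma pmul_assoc_iff (x y z : R) :
    D.pmul f (D.pmul f x y) z = D.pmul f x (D.pmul f y z) ↔
      P.act (D.modr f (x * y)) (P.act z P.gen) = P.act (x * y) (P.act z P.gen) := by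
  rw [← P.pmul_pmul_left, ← P.pmul_pmul_right]
  exact ⟨fun h => by rw [h],
    P.eq_of_act_gen (P.monic.modr_mem _) (P.monic.modr_mem _)⟩

lemma mem_nucr_iff (hm : 2 ≤ m) {x : R} :
    x ∈ D.nucr f m ↔ x ∈ D.SfSet m ∧ P.act f (P.act x P.gen) = 0 := by
  refine and_congr_right fun _ => ⟨fun h => ?_, fun h y _ z _ => ?_⟩
  · have key := (P.pmul_assoc_iff _ _ _).1 (h (D.t ^ 1) (D.t_pow_mem (by omega)) (D.t ^ (m - 1))
      (D.t_pow_mem (by omega)))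
    rw [← pow_add, Nat.add_sub_cancel' (by omega)] at key
    have hmod := P.monic.modr_of_degree_le (x := D.t ^ m) fun j hj => by
      rw [coeff_t_pow, Finsupp.single_eq_of_ne (by omega)]
    rw [coeff_t_pow, Finsupp.single_eq_same, map_one, one_mul] at hmod
    conv_rhs at key => rw [hmod, act_add]
    exact right_eq_add.1 key
  · rw [P.pmul_assoc_iff, P.act_modr h]

lemma exists_act_modr_ne {v : V} (hv : P.act f v ≠ 0) {x : R}
    (hx : ∀ j, m < j → D.coeff x j = 0) (hxm : D.coeff x m ≠ 0) :
    ∃ z ∈ D.SfSet m, P.act (D.modr f x) (P.act z P.gen) ≠ P.act x (P.act z P.gen) := by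
  obtain ⟨z, hz, rfl⟩ := P.exists_act_eq v
  refine ⟨z, hz, fun h => hv ?_⟩
  conv_rhs at h => rw [P.monic.modr_of_degree_le hx, act_add]
  rw [right_eq_add, act_mul, act_i, smul_eq_zero] at h
  exact h.resolve_left hxm

lemma exists_degree {x : R} (hx : x ∈ D.SfSet m) (hxi : x ∉ Set.range D.i) :
    ∃ d, 0 < d ∧ d < m ∧ D.coeff x d ≠ 0 ∧ ∀ j, d < j → D.coeff x j = 0 := by
  have hne : D.coeff x ≠ 0 := fun h =>
    hxi ⟨0, by rw [map_zero]; exact (D.coeff_injective (by rw [h, D.coeff_zero])).symm⟩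
  obtain ⟨d, -, hd, hlt⟩ := DiffOp.exists_support_max_eq hne
  refine ⟨d, Nat.pos_of_ne_zero ?_, ?_, hd, hlt⟩
  · rintro rfl
    refine hxi ⟨D.coeff x 0, D.coeff_injective (Finsupp.ext fun j => ?_)⟩
    rw [coeff_i]
    rcases Nat.eq_zero_or_pos j with rfl | hj
    · rw [Finsupp.single_eq_same]
    · rw [hlt j hj, Finsupp.single_eq_of_ne (by omega)]
  · by_contra! h
    exact hd (D.mem_SfSet_iff.1 hx d h)

include P in
lemma nucl_eq (hm : 0 < m) {v : V} (hv : P.act f v ≠ 0) : D.nucl f m = Set.range D.i := by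
  ext x
  constructor
  · rintro ⟨hx, h⟩
    by_contra hxi
    obtain ⟨d, hd, hdm, hxd, hlt⟩ := exists_degree hx hxi
    have hc := DiffOp.op_apply δ (c' := D.coeff (D.t ^ (m - d))) (k := m - d) hlt (fun j hj => by
      rw [coeff_t_pow, Finsupp.single_eq_of_ne (by omega)])
    rw [← coeff_mul_op, Nat.add_sub_cancel' hdm.le, coeff_t_pow, Finsupp.single_eq_same,
      mul_one] at hc
    obtain ⟨z, hz, hne⟩ := P.exists_act_modr_ne hv hc.1 (hc.2 ▸ hxd)
    exact hne ((P.pmul_assoc_iff _ _ _).1 (h _ (D.t_pow_mem (by omega)) z hz))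
  · rintro ⟨a, rfl⟩
    refine ⟨D.i_mem hm a, fun y hy z _ => ?_⟩
    rw [P.pmul_assoc_iff, P.monic.modr_of_mem (D.i_mul_mem hy a)]

include P in
lemma nucm_eq (hm : 0 < m) {v : V} (hv : P.act f v ≠ 0) : D.nucm f m = Set.range D.i := by
  ext x
  constructor
  · rintro ⟨hx, h⟩
    by_contra hxi
    obtain ⟨d, hd, hdm, hxd, hlt⟩ := exists_degree hx hxi
    have hc := DiffOp.op_apply δ (c := D.coeff (D.t ^ (m - d))) (n := m - d) (fun j hj => by
      rw [coeff_t_pow, Finsupp.single_eq_of_ne (by omega)]) hlt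
    rw [← coeff_mul_op, Nat.sub_add_cancel hdm.le, coeff_t_pow, Finsupp.single_eq_same,
      one_mul] at hc
    obtain ⟨z, hz, hne⟩ := P.exists_act_modr_ne hv hc.1 (hc.2 ▸ hxd)
    exact hne ((P.pmul_assoc_iff _ _ _).1 (h _ (D.t_pow_mem (by omega)) z hz))
  · rintro ⟨a, rfl⟩
    refine ⟨D.i_mem hm a, fun y hy z _ => ?_⟩
    rw [P.pmul_assoc_iff, P.monic.modr_of_mem (D.mul_i_mem hy a)]

lemma act_comm {M : Module.End K V} (hM : ∀ v, M (P.act D.t v) = P.act D.t (M v)) (x : R) (v : V) :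
    M (P.act x v) = P.act x (M v) := by
  induction x using D.induction with
  | hadd x y hx hy => rw [act_add, map_add, hx, hy, act_add]
  | hmon n a =>
    rw [act_mul, act_mul, act_i, act_i, map_smul]
    congr 1
    induction n generalizing v with
    | zero => simp
    | succ n ih => rw [pow_succ, act_mul, act_mul, ih, hM]

/-- Elements of the right nucleus are induced by endomorphisms of the cyclic module. -/
lemma exists_end {u : V} (hu : P.act f u = 0) :
    ∃ M : Module.End K V, M P.gen = u ∧ ∀ v, M (P.act D.t v) = P.act D.t (M v) := by
  choose g _ hg using P.exists_act_eq
  have hwd : ∀ {y y'}, P.act y P.gen = P.act y' P.gen → P.act y u = P.act y' u := fun {y y'} h => by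
    rw [← sub_eq_zero, ← act_sub] at h ⊢
    exact P.act_eq_zero_of_act_gen h hu
  have hact : ∀ x v, P.act (g (P.act x v)) u = P.act x (P.act (g v) u) := fun x v => by
    rw [← act_mul]
    exact hwd (by rw [hg, act_mul, hg])
  refine ⟨⟨⟨fun v => P.act (g v) u, fun v w => ?_⟩, fun a v => ?_⟩, ?_, fun v => hact _ v⟩
  · rw [← act_add]
    exact hwd (by rw [hg, act_add, hg, hg])
  · simpa only [act_i, RingHom.id_apply] using hact (D.i a) v
  · have : P.act 1 u = u := by rw [map_one]; rfl
    exact (hwd (by rw [hg, map_one]; rfl)).trans this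

lemma rightNucPresents (hm : 2 ≤ m) {F B : Type} [Field F] [Algebra F K] [Ring B] [Algebra F B]
    (ρ : B →+ Module.End K V) (hmul : ∀ b c, ρ (b * c) = ρ c * ρ b)
    (halg : ∀ c v, ρ (algebraMap F B c) v = algebraMap F K c • v) (hinj : Function.Injective ρ)
    (hcomm : ∀ M : Module.End K V,
      (∀ v, M (P.act D.t v) = P.act D.t (M v)) ↔ ∃ b, ρ b = M) :
    D.RightNucPresents F f m B := by
  have hρ : ∀ b x v, ρ b (P.act x v) = P.act x (ρ b v) := fun b =>
    P.act_comm ((hcomm (ρ b)).2 ⟨b, rfl⟩)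
  have hext : ∀ {M N : Module.End K V}, (∀ v, M (P.act D.t v) = P.act D.t (M v)) →
      (∀ v, N (P.act D.t v) = P.act D.t (N v)) → M P.gen = N P.gen → M = N :=
    fun {M N} hM hN h => LinearMap.ext fun v => by
      obtain ⟨x, -, rfl⟩ := P.exists_act_eq v
      rw [P.act_comm hM, P.act_comm hN, h]
  choose g hgmem hg using P.exists_act_eq
  have huniq : ∀ {x}, x ∈ D.SfSet m → g (P.act x P.gen) = x := fun {x} hx =>
    P.eq_of_act_gen (hgmem _) hx (hg _)
  have hnuc : ∀ b, g (ρ b P.gen) ∈ D.nucr f m := fun b =>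
    (P.mem_nucr_iff hm).2 ⟨hgmem _, by rw [hg, ← hρ, P.act_gen, map_zero]⟩
  refine ⟨Equiv.ofBijective (fun b => ⟨g (ρ b P.gen), hnuc b⟩) ⟨fun b c h => ?_, fun x => ?_⟩,
    fun b c => ?_, fun b c => ?_, fun c => ?_⟩
  · have h' := congrArg (fun x => P.act x P.gen) (congrArg Subtype.val h)
    simp only [hg] at h'
    exact hinj (hext ((hcomm _).2 ⟨b, rfl⟩) ((hcomm _).2 ⟨c, rfl⟩) h')
  · obtain ⟨x, hx⟩ := x
    obtain ⟨hxS, hfx⟩ := (P.mem_nucr_iff hm).1 hx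
    obtain ⟨M, hMgen, hM⟩ := P.exists_end hfx
    obtain ⟨b, rfl⟩ := (hcomm M).1 hM
    exact ⟨b, Subtype.ext (by simp only [hMgen, huniq hxS])⟩
  · change g (ρ (b + c) P.gen) = g (ρ b P.gen) + g (ρ c P.gen)
    refine P.eq_of_act_gen (hgmem _) (D.add_mem (hgmem _) (hgmem _)) ?_
    rw [act_add, hg, hg, hg, map_add, LinearMap.add_apply]
  · change g (ρ (b * c) P.gen) = D.modr f (g (ρ b P.gen) * g (ρ c P.gen))
    refine P.eq_of_act_gen (hgmem _) (P.monic.modr_mem _) ?_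
    rw [P.act_modr P.act_gen, act_mul, hg, hg, hmul, Module.End.mul_apply, ← hρ, hg]
  · change g (ρ (algebraMap F B c) P.gen) = _
    refine P.eq_of_act_gen (hgmem _) (D.i_mem (by omega) _) ?_
    rw [hg, halg, act_i]

/-- The scalars in the right nucleus form an intermediate field. -/
lemma exists_intermediateField (hm : 2 ≤ m) {F : Type} [Field F] [Algebra F K]
    [Algebra.IsAlgebraic F K] (hδ : δ.HasConstants F) {a : K} (ha : P.act f (a • P.gen) ≠ 0) :
    ∃ E : IntermediateField F K, D.nucr f m ∩ Set.range D.i = D.i '' (E : Set K) ∧ E ≠ ⊤ := by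
  let S : Subalgebra F K :=
    { carrier := {a | P.act f (a • P.gen) = 0}
      mul_mem' := fun {a b} ha hb => by
        simp only [Set.mem_ofPred_eq] at ha hb ⊢
        rw [mul_smul, ← P.act_i a, ← act_mul]
        rw [← P.act_i a, ← act_mul] at ha
        exact P.act_eq_zero_of_act_gen ha hb
      add_mem' := fun {a b} ha hb => by
        simp only [Set.mem_ofPred_eq] at ha hb ⊢
        rw [add_smul, map_add, ha, hb, add_zero]
      algebraMap_mem' := fun c => by
        rw [Set.mem_ofPred_eq, ← P.act_i, ← act_mul,
          D.mul_i_of_constant (hδ.apply_algebraMap c), act_mul, P.act_gen, map_zero] }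
  refine ⟨S.toIntermediateField fun x hx => S.inv_mem_of_algebraic (x := ⟨x, hx⟩)
    (Algebra.IsAlgebraic.isAlgebraic x), ?_, fun h => ha ?_⟩
  · ext x
    constructor
    · rintro ⟨hx, a, rfl⟩
      refine ⟨a, ?_, rfl⟩
      have := ((P.mem_nucr_iff hm).1 hx).2
      rwa [act_i] at this
    · rintro ⟨a, ha, rfl⟩
      exact ⟨(P.mem_nucr_iff hm).2 ⟨D.i_mem (by omega) a, by rw [act_i]; exact ha⟩, a, rfl⟩
  · have : a ∈ (⊤ : IntermediateField F K) := IntermediateField.mem_top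
    rw [← h] at this
    exact this

end CyclicPresentation

end DiffPolyRing

/-- A cyclic vector of a pseudo-linear map gives a cyclic presentation. -/
lemma DiffPolyRing.exists_cyclicPresentation {K : Type} [Field K] {δ : Der K} {R : Type} [Ring R]
    (D : DiffPolyRing K δ R) {m : ℕ} {T : AddMonoid.End (Fin m → K)}
    (hT : ∀ (a : K) v, T (a • v) = a • T v + δ.toFun a • v) {v : Fin m → K}
    (hv : LinearIndependent K (fun i : Fin m => (T ^ (i : ℕ)) v)) :
    ∃ (c : Fin m → K) (P : D.CyclicPresentation (D.t ^ m - D.ofFn c) m (Fin m → K)),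
      P.gen = v ∧ P.act D.t = T ∧
      ∀ w, P.act (D.t ^ m - D.ofFn c) w = (T ^ m) w - ∑ i, c i • (T ^ (i : ℕ)) w := by
  have hofFn : ∀ (c : Fin m → K) w, D.act hT (D.ofFn c) w = ∑ i, c i • (T ^ (i : ℕ)) w := by
    intro c w
    rw [ofFn, map_sum]
    refine (AddMonoidHom.finsetSum_apply _ _ w).trans ?_
    refine Finset.sum_congr rfl fun i _ => ?_
    rw [map_mul, map_pow, act_t]
    exact D.act_i hT _ _
  have hspan : ∀ w, ∃ c : Fin m → K, ∑ i, c i • (T ^ (i : ℕ)) v = w := fun w => by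
    rw [← Submodule.mem_span_range_iff_exists_fun, hv.span_eq_top_of_card_eq_finrank' (by simp)]
    exact Submodule.mem_top
  obtain ⟨c, hc⟩ := hspan ((T ^ m) v)
  have hf : ∀ w, D.act hT (D.t ^ m - D.ofFn c) w = (T ^ m) w - ∑ i, c i • (T ^ (i : ℕ)) w := by
    intro w
    rw [map_sub, map_pow, act_t, ← hofFn]
    rfl
  refine ⟨c, ⟨⟨?_, fun j hj => ?_⟩, D.act hT, D.act_i hT, v, ?_, fun x hx h => ?_, fun w => ?_⟩,
    rfl, D.act_t hT, hf⟩
  · rw [coeff_sub, coeff_t_pow, Finsupp.sub_apply, (D.coeff_ofFn c).2 m le_rfl,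
      Finsupp.single_eq_same, sub_zero]
  · rw [coeff_sub, coeff_t_pow, Finsupp.sub_apply, (D.coeff_ofFn c).2 j hj.le,
      Finsupp.single_eq_of_ne hj.ne', sub_zero]
  · rw [hf, hc, sub_self]
  · rw [← D.ofFn_coeff hx, hofFn] at h
    have hzero : (fun j : Fin m => D.coeff x j) = 0 :=
      funext (Fintype.linearIndependent_iff.1 hv _ h)
    rw [← D.ofFn_coeff hx, hzero]
    simp [ofFn]
  · obtain ⟨b, rfl⟩ := hspan w
    exact ⟨D.ofFn b, D.ofFn_mem b, hofFn b v⟩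

/-- Over a finite field there are no proper purely inseparable extensions. -/
lemma infinite_of_pow_mem_range (p : ℕ) [Fact p.Prime] (F K : Type) [Field F] [CharP F p]
    [Field K] [Algebra F K] [FiniteDimensional F K]
    (hK : ∀ z : K, z ^ p ∈ (algebraMap F K).range) (hF : 1 < Module.finrank F K) : Infinite F := by
  by_contra h
  rw [not_infinite_iff_finite] at h
  have : Finite K := Module.finite_of_finite F
  have : CharP K p := charP_of_injective_algebraMap (algebraMap F K).injective p
  refine absurd hF (not_lt.2 (finrank_le_one (1 : K) fun w => ?_))
  obtain ⟨z, rfl⟩ := Finite.surjective_of_injective (frobenius_inj K p) w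
  obtain ⟨c, hc⟩ := hK z
  exact ⟨c, by rw [← Algebra.algebraMap_eq_smul_one, hc, frobenius_def]⟩

/-- Let `B` be a `p`-algebra of degree `m` over `F` split by a purely
inseparable extension `K/F` of exponent one with `m < [K:F] = p^e`.  Then there are an
algebraic derivation `δ` on `K` with constants `F` and `f ∈ K[t;δ]` of degree `m` such that
the Petit algebra `S_f` is a unital nonassociative `F`-algebra of dimension `m·p^e` whose
right nucleus is isomorphic to `B`, whose left and middle nuclei equal `K`, and whose
nucleus `Nuc(S_f) = B ∩ K` is an intermediate field of `K/F` properly contained in `K`. -/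
theorem statement_7 (p : ℕ) [Fact p.Prime] (F K B : Type) [Field F] [CharP F p]
    [Field K] [Algebra F K] [Ring B] [Algebra F B] (e m : ℕ) (hm : 2 ≤ m)
    (hmlt : m < p ^ e)
    (hpureinsep : ∀ z : K, z ^ p ∈ (algebraMap F K).range)
    (hdim : Module.finrank F K = p ^ e)
    (hpalg : IsPAlgebra p F B) (hdegB : Module.finrank F B = m ^ 2)
    (hsplit : Nonempty ((K ⊗[F] B) ≃ₐ[K] Matrix (Fin m) (Fin m) K)) :
    ∃ δ : Der K, δ.HasConstants F ∧
      (∃ (e' : ℕ) (c : Fin e' → F), ∀ a : K, δ.toFun^[p ^ e'] a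
        + ∑ i : Fin e', algebraMap F K (c i) * δ.toFun^[p ^ (e' - 1 - (i : ℕ))] a = 0) ∧
      ∃ (R : Type) (_ : Ring R) (D : DiffPolyRing K δ R) (f : R),
        D.deg f = (m : WithBot ℕ) ∧
        D.PetitUnital f m ∧
        Module.finrank F (D.Rlt m) = m * p ^ e ∧
        D.RightNucPresents F f m B ∧
        D.nucl f m = Set.range D.i ∧
        D.nucm f m = Set.range D.i ∧
        D.nuc f m = D.nucr f m ∩ Set.range D.i ∧
        ∃ E : IntermediateField F K, D.nuc f m = D.i '' (E : Set K) ∧ E ≠ ⊤ := by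
  have hpe : 0 < Module.finrank F K := by omega
  have : FiniteDimensional F K := Module.finite_of_finrank_pos hpe
  have : Infinite F := infinite_of_pow_mem_range p F K hpureinsep (by omega)
  obtain ⟨d, hd⟩ := exists_derivation_constants p F K hpureinsep
  let δ : Der K := ⟨d, d.map_add, fun a b => by
    rw [d.leibniz, smul_eq_mul, smul_eq_mul, mul_comm b]⟩
  have hδ : δ.HasConstants F := hd
  refine ⟨δ, hδ, ?_, ?_⟩
  · obtain ⟨n, c, h⟩ :=
      exists_add_sum_smul_eq_zero (F := F) fun n => Der.toLinearMap hδ ^ p ^ n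
    refine ⟨n, c, fun a => ?_⟩
    have ha := LinearMap.congr_fun h a
    simp only [LinearMap.add_apply, LinearMap.sum_apply, LinearMap.smul_apply,
      Der.toLinearMap_pow] at ha
    simpa only [Algebra.smul_def, LinearMap.zero_apply] using ha
  obtain ⟨Φ⟩ := hsplit
  obtain ⟨T, ρ, hT, hmul, halg, hinj, hcomm⟩ := exists_pseudoLinear hδ (by omega) Φ
  have hfin : Module.finrank K (Fin m → K) = m := Module.finrank_fin_fun K
  obtain ⟨v, hv⟩ := exists_cyclic_vector hδ hT (by omega)
  rw [hfin] at hv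
  let D := diffPolyRing δ
  obtain ⟨c, P, hgen, ht, hf⟩ := D.exists_cyclicPresentation hT hv
  obtain ⟨i, hi⟩ : ∃ i, v i ≠ 0 := by
    by_contra! h
    exact hv.ne_zero (⟨0, by omega⟩ : Fin m) (funext h : v = 0)
  obtain ⟨a, ha⟩ := exists_functional_apply_ne_zero hδ hT (n := m) (by omega) c
    (LinearMap.proj i) hi
  have hav : P.act (D.t ^ m - D.ofFn c) (a • P.gen) ≠ 0 := fun h => ha <| by
    rw [← hf, ← hgen, h, map_zero]
  have hl := P.nucl_eq (by omega) hav
  have hmid := P.nucm_eq (by omega) hav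
  have hnuc : D.nuc (D.t ^ m - D.ofFn c) m =
      D.nucr (D.t ^ m - D.ofFn c) m ∩ Set.range D.i := by
    rw [DiffPolyRing.nuc, hl, hmid, Set.inter_self, Set.inter_comm]
  refine ⟨DiffOp.ring δ, inferInstance, D, D.t ^ m - D.ofFn c, P.monic.deg_eq,
    P.monic.petitUnital (by omega), ?_,
    P.rightNucPresents hm ρ hmul halg hinj fun M => by rw [ht]; exact hcomm M, hl, hmid, hnuc, ?_⟩
  · rw [D.finrank_Rlt, hdim]
  · rw [hnuc]
    exact P.exists_intermediateField hm hδ hav
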